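/- Let u_0, u_1, …, u_{N−1} be nonzero vectors in ℝ^d, and for each pair i, j set ρ_{ij} = max{‖u_i‖_∞/‖u_i‖₂, ‖u_j‖_∞/‖u_j‖₂} and θ_{ij} = ∠(u_i, u_j). Let ε > 0, let k = C log²N/ε² with C = 144, and assume k < N and k < d. Let Φ_i = sign(C_{r,k} D u_i) be the k-bit circulant binary embeddings (with a single random Gaussian r and Rademacher diagonal D shared by all points). Then with probability at least 3/4, for every pair i, j with ρ_{ij} < θ_{ij}²/(16 k log(2kN²)), one has |(1/(2k))‖Φ_i − Φ_j‖₁ − θ_{ij}/π| < ε. -/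

import Mathlib

open MeasureTheory ProbabilityTheory Real
open scoped ENNReal

noncomputable section

/-- Entrywise sign: `sgn t = 1` if `t ≥ 0`, `-1` otherwise. -/
def sgn (t : ℝ) : ℝ := if 0 ≤ t then 1 else -1

/-- Euclidean (ℓ²) norm. -/
def l2norm {ι : Type*} [Fintype ι] (x : ι → ℝ) : ℝ := Real.sqrt (∑ i, x i ^ 2)

/-- Entrywise ℓ¹ norm. -/
def l1norm {ι : Type*} [Fintype ι] (x : ι → ℝ) : ℝ := ∑ i, |x i|

/-- Supremum (ℓ∞) norm. -/
def linf {ι : Type*} [Fintype ι] (x : ι → ℝ) : ℝ := ⨆ i, |x i|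

/-- Euclidean inner product. -/
def dotp {ι : Type*} [Fintype ι] (x y : ι → ℝ) : ℝ := ∑ i, x i * y i

/-- Angle between two vectors. -/
def angle' {ι : Type*} [Fintype ι] (x y : ι → ℝ) : ℝ :=
  Real.arccos (dotp x y / (l2norm x * l2norm y))

/-- The standard Gaussian measure on `ℝ^d` (i.i.d. `N(0,1)` coordinates). -/
def gaussPi (d : ℕ) : Measure (Fin d → ℝ) := Measure.pi fun _ => gaussianReal 0 1

/-- The Rademacher measure on `ℝ`: `±1` with probability `1/2` each. -/
def radMeasure : Measure ℝ := (2 : ℝ≥0∞)⁻¹ • (Measure.dirac 1 + Measure.dirac (-1))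

instance : IsProbabilityMeasure radMeasure := by
  constructor
  simp only [radMeasure, Measure.smul_apply, Measure.coe_add, Pi.add_apply,
    Measure.dirac_apply' _ MeasurableSet.univ, Set.indicator_univ, Pi.one_apply, smul_eq_mul]
  rw [one_add_one_eq_two, ENNReal.inv_mul_cancel] <;> simp

instance (d : ℕ) : IsProbabilityMeasure (gaussPi d) := by
  unfold gaussPi; infer_instance

/-- i.i.d. Rademacher signs on `ℝ^d`. -/
def radPi (d : ℕ) : Measure (Fin d → ℝ) := Measure.pi fun _ => radMeasure

instance (d : ℕ) : IsProbabilityMeasure (radPi d) := by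
  unfold radPi; infer_instance

/-- Circular shift by `t` positions: the `j`-th entry of `shift t x` is `x ((j - t) mod d)`. -/
def shift {d : ℕ} (t : ℕ) (x : Fin d → ℝ) : Fin d → ℝ :=
  fun j => x ⟨((j : ℕ) + (d - t % d)) % d, Nat.mod_lt _ j.pos⟩

/-- The `k`-bit circulant binary embedding: `sign` of the first `k` entries of
`circ(r) · D · x`, where `D = diag D`. -/
def cbe {d k : ℕ} (hk : k ≤ d) (r D x : Fin d → ℝ) : Fin k → ℝ :=
  fun i => sgn (∑ j, r (Fin.castLE hk i - j) * (D j * x j))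


lemma map_dotp_orthogonal {κ ι : Type*} [Fintype κ] [Fintype ι] [DecidableEq ι]
    (a : ι → κ → ℝ) (v : ι → NNReal)
    (h : ∀ i j, dotp (a i) (a j) = if i = j then (v i : ℝ) else 0) :
    (Measure.pi fun _ : κ => gaussianReal 0 1).map (fun r i => dotp r (a i)) =
      Measure.pi fun i => gaussianReal 0 (v i) := by
  have hm : Measurable (fun (r : κ → ℝ) (i : ι) => dotp r (a i)) := by
    unfold dotp; fun_prop
  have : IsProbabilityMeasure ((Measure.pi fun _ : κ => gaussianReal 0 1).map
    (fun r i => dotp r (a i))) := Measure.isProbabilityMeasure_map hm.aemeasurable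
  rw [← charFun_eq_pi_iff]
  intro t
  have h1 : charFun (((Measure.pi fun _ : κ => gaussianReal 0 1).map
      (fun r i => dotp r (a i))).map (WithLp.toLp 2)) t =
      ∏ l, charFun (gaussianReal 0 1) (∑ i, a i l * t i) := by
    rw [charFun, integral_map (by fun_prop) (by fun_prop),
      integral_map hm.aemeasurable (by fun_prop)]
    simp_rw [charFun]
    rw [← integral_fintype_prod_eq_prod (𝕜 := ℂ)
      (f := fun l x => Complex.exp ((inner ℝ x (∑ i, a i l * t i) : ℝ) * Complex.I))]
    congr 1
    ext r
    rw [← Complex.exp_sum, ← Finset.sum_mul]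
    congr 2
    rw [← Complex.ofReal_sum]
    congr 1
    simp only [PiLp.inner_apply, dotp, RCLike.inner_apply, conj_trivial, Finset.mul_sum,
      Finset.sum_mul]
    rw [Finset.sum_comm]
    exact Finset.sum_congr rfl fun _ _ => Finset.sum_congr rfl fun _ _ => by ring
  have h2 : ∑ l, (∑ i, a i l * t i) ^ 2 = ∑ i, (v i : ℝ) * t i ^ 2 := by
    have : ∀ i, (v i : ℝ) * t i ^ 2 = ∑ j, t i * t j * dotp (a i) (a j) := by
      intro i
      simp [h]; ring
    simp_rw [this, dotp, sq, Finset.sum_mul, Finset.mul_sum]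
    rw [Finset.sum_comm]
    refine Finset.sum_congr rfl fun i _ => ?_
    rw [Finset.sum_comm]
    exact Finset.sum_congr rfl fun _ _ => Finset.sum_congr rfl fun _ _ => by ring
  rw [h1]
  simp_rw [charFun_gaussianReal, ← Complex.exp_sum]
  congr 1
  simp only [Complex.ofReal_zero, mul_zero, zero_mul, zero_sub, NNReal.coe_one, Complex.ofReal_one,
    one_mul, Finset.sum_neg_distrib, ← Finset.sum_div]
  congr 2
  exact_mod_cast h2

lemma lintegral_pi_prod {ι E : Type*} [Fintype ι] [MeasurableSpace E]
    (μ : ι → Measure E) [∀ i, IsProbabilityMeasure (μ i)] (f : ι → E → ℝ≥0∞)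
    (hf : ∀ i, Measurable (f i)) :
    ∫⁻ z, ∏ i, f i (z i) ∂(Measure.pi μ) = ∏ i, ∫⁻ x, f i x ∂(μ i) := by
  have := lintegral_prod_eq_prod_lintegral_of_indepFun (μ := Measure.pi μ) Finset.univ
    (fun i z => f i (z i)) (iIndepFun_pi (X := f) fun i => (hf i).aemeasurable)
    (fun i => (hf i).comp (measurable_pi_apply i))
  rw [this]
  refine Finset.prod_congr rfl fun i _ => ?_
  rw [← lintegral_map (hf i) (measurable_pi_apply i)]
  congr 1
  exact (measurePreserving_eval μ i).map_eq

lemma pi_withDensity_eq {ι E : Type*} [Fintype ι] [MeasurableSpace E]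
    (μ ν : ι → Measure E) [∀ i, IsProbabilityMeasure (μ i)] [∀ i, IsProbabilityMeasure (ν i)]
    (f : ι → E → ℝ≥0∞)
    (hf : ∀ i, Measurable (f i)) (h : ∀ i, ν i = (μ i).withDensity (f i)) :
    Measure.pi ν = (Measure.pi μ).withDensity (fun z => ∏ i, f i (z i)) := by
  refine (Measure.pi_eq fun s hs => ?_)
  rw [withDensity_apply _ (MeasurableSet.univ_pi hs), ← lintegral_indicator (MeasurableSet.univ_pi hs)]
  have : ∀ z : ι → E, (Set.univ.pi s).indicator (fun z => ∏ i, f i (z i)) z =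
      ∏ i, (s i).indicator (f i) (z i) := by
    intro z
    by_cases hz : z ∈ Set.univ.pi s
    · rw [Set.indicator_of_mem hz]
      exact Finset.prod_congr rfl fun i _ => (Set.indicator_of_mem (hz i trivial) _).symm
    · rw [Set.indicator_of_notMem hz]
      simp only [Set.mem_pi, Set.mem_univ, true_imp_iff, not_forall] at hz
      obtain ⟨i, hi⟩ := hz
      exact (Finset.prod_eq_zero (Finset.mem_univ i) (Set.indicator_of_notMem hi _)).symm
  simp_rw [this]
  rw [lintegral_pi_prod μ _ fun i => (hf i).indicator (hs i)]
  refine Finset.prod_congr rfl fun i _ => ?_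
  rw [lintegral_indicator (hs i), h, withDensity_apply _ (hs i)]

/-- The density of `N(0, v)` with respect to `N(0, 1)`. -/
def gaussRatio (v x : ℝ) : ℝ := (√v)⁻¹ * exp (x ^ 2 / 2 - x ^ 2 / (2 * v))

lemma measurable_gaussRatio (v : ℝ) : Measurable (gaussRatio v) := by
  unfold gaussRatio; fun_prop

lemma gaussRatio_nonneg (v x : ℝ) : 0 ≤ gaussRatio v x := by
  unfold gaussRatio; positivity

lemma gaussianReal_eq_withDensity_ratio (v : NNReal) (hv : v ≠ 0) :
    gaussianReal 0 v =
      (gaussianReal 0 1).withDensity fun x => ENNReal.ofReal (gaussRatio v x) := by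
  rw [gaussianReal_of_var_ne_zero _ hv, gaussianReal_of_var_ne_zero _ one_ne_zero,
    ← withDensity_mul _ (measurable_gaussianPDF _ _)
      (measurable_gaussRatio _).ennreal_ofReal]
  congr 1
  ext x
  simp only [gaussianPDF, Pi.mul_apply]
  rw [← ENNReal.ofReal_mul (gaussianPDFReal_nonneg _ _ _)]
  congr 1
  simp only [gaussianPDFReal, gaussRatio, NNReal.coe_one, mul_one, sub_zero]
  rw [Real.sqrt_mul (by positivity) (v : ℝ), mul_inv,
    mul_mul_mul_comm, mul_assoc ((√(2 * π))⁻¹) ((√(v:ℝ))⁻¹) _, ← mul_assoc, ← exp_add]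
  congr 2
  ring

lemma inv_sqrt_one_sub_sq_le {e : ℝ} (he : e ^ 2 ≤ 1 / 4) :
    (√(1 - e ^ 2))⁻¹ ≤ exp (e ^ 2) := by
  have h1 : 0 < 1 - e ^ 2 := by linarith
  rw [inv_le_comm₀ (by positivity) (by positivity), ← exp_neg]
  apply Real.le_sqrt_of_sq_le
  rw [← exp_nat_mul]
  have h2 := Real.add_one_le_exp (2 * e ^ 2)
  have h3 : exp (((2 : ℕ) : ℝ) * -e ^ 2) * exp (2 * e ^ 2) = 1 := by
    rw [← exp_add]; simp
  have h4 := exp_pos (((2 : ℕ) : ℝ) * -e ^ 2)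
  have h5 : 1 ≤ (1 - e ^ 2) * exp (2 * e ^ 2) := by
    nlinarith [sq_nonneg e, mul_nonneg (sq_nonneg e) (by linarith : 0 ≤ 1 / 4 - e ^ 2)]
  nlinarith

lemma lintegral_gaussRatio_sq_le {e : ℝ} (he : e ^ 2 ≤ 1 / 4) :
    ∫⁻ x, ENNReal.ofReal (gaussRatio (1 + e) x) ^ 2 ∂(gaussianReal 0 1) ≤
      ENNReal.ofReal (exp (e ^ 2)) := by
  have he' : |e| ≤ 1 / 2 := abs_le_of_sq_le_sq (by linarith) (by norm_num)
  obtain ⟨h1, h2⟩ := abs_le.1 he'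
  have hv : 0 < 1 + e := by linarith
  set b : ℝ := 1 / (1 + e) - 1 / 2 with hb
  have hb0 : 0 < b := by
    rw [hb, sub_pos, one_div_lt_one_div (by norm_num) hv]; linarith
  rw [gaussianReal_of_var_ne_zero _ one_ne_zero,
    lintegral_withDensity_eq_lintegral_mul _ (measurable_gaussianPDF _ _)
      ((measurable_gaussRatio _).ennreal_ofReal.pow_const 2)]
  have hpt : ∀ x, (gaussianPDF 0 1 * fun x => ENNReal.ofReal (gaussRatio (1 + e) x) ^ 2) x =
      ENNReal.ofReal ((√(2 * π))⁻¹ * (1 + e)⁻¹ * exp (-b * x ^ 2)) := by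
    intro x
    simp only [gaussianPDF, Pi.mul_apply]
    rw [← ENNReal.ofReal_pow (gaussRatio_nonneg _ _),
      ← ENNReal.ofReal_mul (gaussianPDFReal_nonneg _ _ _)]
    congr 1
    simp only [gaussianPDFReal, gaussRatio, NNReal.coe_one, mul_one, sub_zero]
    rw [mul_pow, inv_pow, Real.sq_sqrt hv.le, ← exp_nat_mul, mul_mul_mul_comm, ← exp_add]
    congr 2
    rw [hb]
    field_simp
    push_cast
    ring
  simp_rw [hpt]
  rw [← ofReal_integral_eq_lintegral_ofReal ((integrable_exp_neg_mul_sq hb0).const_mul _)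
    (Filter.Eventually.of_forall fun x => by positivity), integral_const_mul, integral_gaussian]
  apply ENNReal.ofReal_le_ofReal
  refine le_trans (le_of_eq ?_) (inv_sqrt_one_sub_sq_le he)
  have h3 : (1 - e ^ 2) = (2 * π) * (1 + e) ^ 2 / (π / b) := by
    have : b = (1 - e) / (2 * (1 + e)) := by rw [hb]; field_simp; ring
    rw [this]; field_simp; ring
  have h4 : √(1 - e ^ 2) = √(2 * π) * (1 + e) / √(π / b) := by
    rw [h3, Real.sqrt_div (by positivity : 0 ≤ 2 * π * (1 + e) ^ 2),
      Real.sqrt_mul (by positivity : 0 ≤ 2 * π), Real.sqrt_sq hv.le]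
  rw [h4, inv_div, div_eq_mul_inv _ (√(2 * π) * (1 + e)), mul_inv]
  ring

/-- Change of measure: probabilities under a product of Gaussians with variances close to one
(in the `ℓ²` sense) are controlled by standard Gaussian probabilities. -/
lemma pi_gaussian_le_of_variance_close {ι : Type*} [Fintype ι] (e : ι → ℝ)
    (he : ∑ i, e i ^ 2 ≤ 1 / 4) (v : ι → NNReal) (hv : ∀ i, (v i : ℝ) = 1 + e i)
    {S : Set (ι → ℝ)} (hS : MeasurableSet S) {α : ℝ} (hα : 0 < α) :
    (Measure.pi fun i => gaussianReal 0 (v i)) S ≤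
      ENNReal.ofReal (α / 2) * (Measure.pi fun _ : ι => gaussianReal 0 1) S +
        ENNReal.ofReal (1 / α) := by
  have hei : ∀ i, e i ^ 2 ≤ 1 / 4 := fun i =>
    (Finset.single_le_sum (f := fun i => e i ^ 2) (fun _ _ => sq_nonneg _)
      (Finset.mem_univ i)).trans he
  have hv0 : ∀ i, v i ≠ 0 := by
    intro i h0
    have h1 := hv i
    have h2 := hei i
    rw [h0, NNReal.coe_zero] at h1
    nlinarith
  set f : ι → ℝ → ℝ := fun i x => gaussRatio (v i) x with hf
  have hfm : ∀ i, Measurable (fun x => ENNReal.ofReal (f i x)) := fun i =>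
    (measurable_gaussRatio _).ennreal_ofReal
  rw [pi_withDensity_eq (fun _ : ι => gaussianReal 0 1) (fun i => gaussianReal 0 (v i))
    (fun i x => ENNReal.ofReal (f i x)) hfm
    (fun i => gaussianReal_eq_withDensity_ratio (v i) (hv0 i)), withDensity_apply _ hS]
  have hpt : ∀ z : ι → ℝ, ∏ i, ENNReal.ofReal (f i (z i)) ≤
      ENNReal.ofReal (α / 2) +
        ENNReal.ofReal (1 / (2 * α)) * ∏ i, ENNReal.ofReal (f i (z i)) ^ 2 := by
    intro z
    have h0 : 0 ≤ ∏ i, f i (z i) := Finset.prod_nonneg fun i _ => gaussRatio_nonneg _ _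
    rw [Finset.prod_pow, ← ENNReal.ofReal_prod_of_nonneg fun i _ => gaussRatio_nonneg _ _,
      ← ENNReal.ofReal_pow h0, ← ENNReal.ofReal_mul (by positivity),
      ← ENNReal.ofReal_add (by positivity) (by positivity)]
    apply ENNReal.ofReal_le_ofReal
    have : α / 2 + 1 / (2 * α) * (∏ i, f i (z i)) ^ 2 - ∏ i, f i (z i) =
        (α - ∏ i, f i (z i)) ^ 2 / (2 * α) := by field_simp; ring
    have h2 : 0 ≤ (α - ∏ i, f i (z i)) ^ 2 / (2 * α) := by positivity
    linarith
  calc ∫⁻ z in S, ∏ i, ENNReal.ofReal (f i (z i)) ∂(Measure.pi fun _ : ι => gaussianReal 0 1)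
      ≤ ∫⁻ z in S, (ENNReal.ofReal (α / 2) +
        ENNReal.ofReal (1 / (2 * α)) * ∏ i, ENNReal.ofReal (f i (z i)) ^ 2)
          ∂(Measure.pi fun _ : ι => gaussianReal 0 1) := lintegral_mono hpt
    _ = ENNReal.ofReal (α / 2) * (Measure.pi fun _ : ι => gaussianReal 0 1) S +
        ENNReal.ofReal (1 / (2 * α)) * ∫⁻ z in S, ∏ i, ENNReal.ofReal (f i (z i)) ^ 2
          ∂(Measure.pi fun _ : ι => gaussianReal 0 1) := by
        have hm : Measurable fun z : ι → ℝ => ∏ i, ENNReal.ofReal (f i (z i)) ^ 2 :=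
          Finset.measurable_prod _ fun i _ => ((hfm i).comp (measurable_pi_apply i)).pow_const 2
        rw [lintegral_add_left measurable_const, setLIntegral_const, lintegral_const_mul _ hm]
    _ ≤ _ := by
        gcongr
        calc _ ≤ ENNReal.ofReal (1 / (2 * α)) * ENNReal.ofReal 2 := by
              gcongr
              refine (setLIntegral_le_lintegral _ _).trans ?_
              rw [lintegral_pi_prod (fun _ : ι => gaussianReal 0 1)
                (fun i x => ENNReal.ofReal (f i x) ^ 2) fun i => (hfm i).pow_const 2]
              calc _ ≤ ∏ i, ENNReal.ofReal (exp (e i ^ 2)) := by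
                    refine Finset.prod_le_prod' fun i _ => ?_
                    simp only [hf, hv]
                    exact lintegral_gaussRatio_sq_le (hei i)
                _ = ENNReal.ofReal (exp (∑ i, e i ^ 2)) := by
                    rw [← ENNReal.ofReal_prod_of_nonneg fun i _ => (exp_pos _).le, exp_sum]
                _ ≤ _ := by
                    apply ENNReal.ofReal_le_ofReal
                    have h1 : exp (∑ i, e i ^ 2) ≤ exp (1 / 4) := exp_le_exp.2 he
                    have h2 : exp (1 / 4 : ℝ) ≤ 2 := by
                      have := Real.exp_bound_div_one_sub_of_interval (x := 1/4)
                        (by norm_num) (by norm_num)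
                      linarith
                    linarith
          _ = _ := by
              rw [← ENNReal.ofReal_mul (by positivity)]
              congr 1
              field_simp

lemma exists_orthogonal_diagonalization {ι : Type*} [Fintype ι] [DecidableEq ι]
    (A : Matrix ι ι ℝ) (hA : A.transpose = A) :
    ∃ (U : Matrix ι ι ℝ) (e : ι → ℝ), U * U.transpose = 1 ∧ U.transpose * U = 1 ∧
      A = U * Matrix.diagonal e * U.transpose := by
  have hH : A.IsHermitian := by
    rw [Matrix.IsHermitian, Matrix.conjTranspose_eq_transpose_of_trivial, hA]
  refine ⟨hH.eigenvectorUnitary, hH.eigenvalues, ?_, ?_, ?_⟩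
  · have := Matrix.mem_unitaryGroup_iff.1 hH.eigenvectorUnitary.2
    rwa [Matrix.star_eq_conjTranspose, Matrix.conjTranspose_eq_transpose_of_trivial] at this
  · have := Matrix.mem_unitaryGroup_iff'.1 hH.eigenvectorUnitary.2
    rwa [Matrix.star_eq_conjTranspose, Matrix.conjTranspose_eq_transpose_of_trivial] at this
  · have := hH.spectral_theorem
    rw [Unitary.conjStarAlgAut_apply, Matrix.star_eq_conjTranspose,
      Matrix.conjTranspose_eq_transpose_of_trivial] at this
    exact this

/-- Linear functionals of a standard Gaussian vector given by a nearly orthonormal family are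
nearly i.i.d. standard Gaussian. -/
lemma gaussian_nearly_orthonormal {κ ι : Type*} [Fintype κ] [Fintype ι] [DecidableEq ι]
    (a : ι → κ → ℝ)
    (h : ∑ i, ∑ j, (dotp (a i) (a j) - if i = j then 1 else 0) ^ 2 ≤ 1 / 4)
    {S : Set (ι → ℝ)} (hS : MeasurableSet S) {α : ℝ} (hα : 0 < α) :
    (Measure.pi fun _ : κ => gaussianReal 0 1) {r | (fun i => dotp r (a i)) ∈ S} ≤
      ENNReal.ofReal (α / 2) * (Measure.pi fun _ : ι => gaussianReal 0 1) S +
        ENNReal.ofReal (1 / α) := by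
  set A : Matrix ι κ ℝ := Matrix.of a with hA
  set E : Matrix ι ι ℝ := A * A.transpose - 1 with hE
  have hEt : E.transpose = E := by
    rw [hE, Matrix.transpose_sub, Matrix.transpose_mul, Matrix.transpose_transpose,
      Matrix.transpose_one]
  have hEij : ∀ i j, E i j = dotp (a i) (a j) - if i = j then 1 else 0 := by
    intro i j
    simp [hE, Matrix.mul_apply, Matrix.one_apply, dotp, hA]
  obtain ⟨U, e, hU1, hU2, hUE⟩ := exists_orthogonal_diagonalization E hEt
  have he : ∑ i, e i ^ 2 ≤ 1 / 4 := by
    have h1 : (E * E.transpose).trace = ∑ i, e i ^ 2 := by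
      rw [hEt]
      conv_lhs => rw [hUE]
      rw [show U * Matrix.diagonal e * U.transpose * (U * Matrix.diagonal e * U.transpose) =
        U * (Matrix.diagonal e * (U.transpose * U) * Matrix.diagonal e * U.transpose) by
          simp only [Matrix.mul_assoc], hU2, Matrix.trace_mul_comm, Matrix.mul_one,
        Matrix.mul_assoc, hU2, Matrix.mul_one, Matrix.diagonal_mul_diagonal,
        Matrix.trace_diagonal]
      simp [sq]
    rw [← h1]
    refine le_trans (le_of_eq ?_) h
    simp [Matrix.trace, Matrix.mul_apply, hEij, sq]
  have hei : ∀ i, e i ^ 2 ≤ 1 / 4 := fun i =>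
    (Finset.single_le_sum (f := fun i => e i ^ 2) (fun _ _ => sq_nonneg _)
      (Finset.mem_univ i)).trans he
  have hpos : ∀ i, 0 ≤ 1 + e i := fun i => by nlinarith [hei i]
  set v : ι → NNReal := fun i => (1 + e i).toNNReal with hv
  set B : Matrix ι κ ℝ := U.transpose * A with hB
  have hBB : B * B.transpose = Matrix.diagonal fun i => 1 + e i := by
    have hAA : A * A.transpose = 1 + U * Matrix.diagonal e * U.transpose := by
      rw [← hUE, hE]; abel
    rw [hB, Matrix.transpose_mul, Matrix.transpose_transpose, Matrix.mul_assoc,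
      ← Matrix.mul_assoc A, hAA, Matrix.add_mul, Matrix.mul_add, Matrix.one_mul, hU2,
      show U.transpose * (U * Matrix.diagonal e * U.transpose * U) =
        (U.transpose * U) * Matrix.diagonal e * (U.transpose * U) by
          simp only [Matrix.mul_assoc], hU2, Matrix.one_mul, Matrix.mul_one,
      ← Matrix.diagonal_one, Matrix.diagonal_add]
  have hY := map_dotp_orthogonal (fun i => B i) v (by
    intro i j
    have := congrFun (congrFun hBB i) j
    simpa [Matrix.mul_apply, dotp, Matrix.diagonal_apply, hv, hpos] using this)
  have hW := map_dotp_orthogonal (fun i => U i) (fun _ : ι => 1) (by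
    intro i j
    have := congrFun (congrFun hU1 i) j
    simpa [Matrix.mul_apply, dotp, Matrix.one_apply] using this)
  have hmY : Measurable (fun (r : κ → ℝ) (i : ι) => dotp r (B i)) := by
    unfold dotp; fun_prop
  have hmW : Measurable (fun (r : ι → ℝ) (i : ι) => dotp r (U i)) := by
    unfold dotp; fun_prop
  set S' : Set (ι → ℝ) := (fun r i => dotp r (U i)) ⁻¹' S with hS'
  have hS'm : MeasurableSet S' := hmW hS
  have hpre : {r : κ → ℝ | (fun i => dotp r (a i)) ∈ S} =
      (fun (r : κ → ℝ) (i : ι) => dotp r (B i)) ⁻¹' S' := by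
    ext r
    rw [hS', ← Set.preimage_comp, Set.mem_ofPred_eq, Set.mem_preimage]
    have : (fun i => dotp r (a i)) =
        ((fun r i => dotp r (U i)) ∘ fun (r : κ → ℝ) (i : ι) => dotp r (B i)) r := by
      have h1 : A.mulVec r = U.mulVec (B.mulVec r) := by
        rw [Matrix.mulVec_mulVec, hB, ← Matrix.mul_assoc, hU1, Matrix.one_mul]
      have h2 : ∀ i, A.mulVec r i = dotp r (a i) := fun i => by
        simp [Matrix.mulVec, dotProduct, dotp, hA, mul_comm]
      have h3 : ∀ i, B.mulVec r i = dotp r (B i) := fun i => by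
        simp [Matrix.mulVec, dotProduct, dotp, mul_comm]
      have h4 : ∀ s i, U.mulVec s i = dotp s (U i) := fun s i => by
        simp [Matrix.mulVec, dotProduct, dotp, mul_comm]
      ext i
      rw [← h2, h1, h4]
      simp only [Function.comp_apply]
      congr 1
      ext l
      exact h3 l
    rw [this]
  have h1 := pi_gaussian_le_of_variance_close e he v (fun i => Real.coe_toNNReal _ (hpos i)) hS'm hα
  rw [← hY, Measure.map_apply hmY hS'm, ← hpre] at h1
  refine h1.trans (le_of_eq ?_)
  congr 2
  rw [hS', ← Measure.map_apply hmW hS, hW]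

lemma ae_radPi (d : ℕ) : ∀ᵐ D ∂(radPi d), ∀ i, D i = 1 ∨ D i = -1 := by
  rw [ae_all_iff]
  intro i
  have h : ∀ᵐ x ∂radMeasure, x = 1 ∨ x = -1 := by
    rw [radMeasure, Measure.ae_ennreal_smul_measure_iff (by simp), ae_add_measure_iff]
    constructor <;> rw [ae_dirac_iff (by measurability)] <;> simp
  exact (Measure.quasiMeasurePreserving_eval (fun _ : Fin d => radMeasure) i).ae h

lemma measurePreserving_neg_radMeasure : MeasurePreserving (fun x : ℝ => -x) radMeasure radMeasure := by
  refine ⟨measurable_neg, ?_⟩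
  rw [radMeasure, Measure.map_smul, Measure.map_add _ _ measurable_neg,
    Measure.map_dirac' measurable_neg, Measure.map_dirac' measurable_neg, neg_neg, add_comm]

lemma measurePreserving_flip {d : ℕ} (i : Fin d) :
    MeasurePreserving (fun D : Fin d → ℝ => Function.update D i (-D i)) (radPi d) (radPi d) := by
  have h := measurePreserving_pi (fun _ : Fin d => radMeasure) (fun _ : Fin d => radMeasure)
    (f := fun j x => if j = i then -x else x) (by
      intro j
      by_cases hj : j = i
      · simpa [hj] using measurePreserving_neg_radMeasure
      · simp only [hj, if_false]
        exact MeasurePreserving.id radMeasure)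
  have h' : (fun D : Fin d → ℝ => Function.update D i (-D i)) =
      fun a j => if j = i then -a j else a j := by
    ext D j
    by_cases hj : j = i
    · subst hj; simp
    · simp [hj]
  rw [h']
  exact h

lemma lintegral_exp_edge_mul_le {d : ℕ} (i p : Fin d) (hp : p ≠ i) (c : ℝ)
    (G : (Fin d → ℝ) → ℝ≥0∞) (hG : Measurable G)
    (hGi : ∀ D, G (Function.update D i (-D i)) = G D) :
    ∫⁻ D, ENNReal.ofReal (exp (c * (D i * D p))) * G D ∂(radPi d) ≤
      ENNReal.ofReal (exp (c ^ 2 / 2)) * ∫⁻ D, G D ∂(radPi d) := by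
  set F : (Fin d → ℝ) → ℝ≥0∞ := fun D => ENNReal.ofReal (exp (c * (D i * D p))) * G D with hF
  have hFm : Measurable F := by
    refine Measurable.mul ?_ hG
    fun_prop
  have h1 : ∫⁻ D, F (Function.update D i (-D i)) ∂(radPi d) = ∫⁻ D, F D ∂(radPi d) :=
    (measurePreserving_flip i).lintegral_comp hFm
  have h2 : 2 * ∫⁻ D, F D ∂(radPi d) =
      ∫⁻ D, (F D + F (Function.update D i (-D i))) ∂(radPi d) := by
    rw [lintegral_add_left hFm, h1, two_mul]
  have h3 : ∫⁻ D, (F D + F (Function.update D i (-D i))) ∂(radPi d) ≤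
      ∫⁻ D, 2 * (ENNReal.ofReal (exp (c ^ 2 / 2)) * G D) ∂(radPi d) := by
    refine lintegral_mono_ae ?_
    filter_upwards [ae_radPi d] with D hD
    simp only [hF, hGi, Function.update_self, Function.update_of_ne hp]
    rw [← add_mul, ← mul_assoc 2 (ENNReal.ofReal _)]
    refine mul_le_mul' ?_ le_rfl
    rw [← ENNReal.ofReal_add (exp_pos _).le (exp_pos _).le,
      show (2 : ℝ≥0∞) = ENNReal.ofReal 2 by simp, ← ENNReal.ofReal_mul (by norm_num)]
    apply ENNReal.ofReal_le_ofReal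
    have h := Real.cosh_le_exp_half_sq c
    rw [Real.cosh_eq] at h
    rcases hD i with hi | hi <;> rcases hD p with hq | hq <;> rw [hi, hq] <;> norm_num <;> linarith
  rw [← h2, lintegral_const_mul _ (hG.const_mul _), lintegral_const_mul _ hG] at h3
  exact (ENNReal.mul_le_mul_iff_right (by norm_num) (by norm_num)).1 h3

/-- Moment generating function of a Rademacher chaos supported on a forest. -/
lemma lintegral_exp_forest_le {d : ℕ} (p : Fin d → Fin d) (c : Fin d → ℝ) (T : Finset (Fin d))
    (hp : ∀ i ∈ T, p i < i) :
    ∫⁻ D, ENNReal.ofReal (exp (∑ i ∈ T, c i * (D i * D (p i)))) ∂(radPi d) ≤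
      ENNReal.ofReal (exp (∑ i ∈ T, c i ^ 2 / 2)) := by
  induction T using Finset.induction_on_max with
  | empty => simp
  | insert m T hm ih =>
    have hmT : m ∉ T := fun h => lt_irrefl _ (hm m h)
    simp_rw [Finset.sum_insert hmT, exp_add, ENNReal.ofReal_mul (exp_pos _).le]
    refine (lintegral_exp_edge_mul_le m (p m) (hp m (Finset.mem_insert_self _ _)).ne (c m) _
      ?_ ?_).trans ?_
    · fun_prop
    · intro D
      congr 2
      refine Finset.sum_congr rfl fun i hi => ?_
      have h1 : i < m := hm i hi
      have h2 : p i < m := (hp i (Finset.mem_insert_of_mem hi)).trans h1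
      rw [Function.update_of_ne h1.ne, Function.update_of_ne h2.ne]
    · gcongr
      exact ih fun i hi => hp i (Finset.mem_insert_of_mem hi)

lemma lintegral_exp_add_le {Ω : Type*} [MeasurableSpace Ω] (μ : Measure Ω) (f g : Ω → ℝ)
    (hf : Measurable f) (hg : Measurable g) {A B : ℝ}
    (hA : ∫⁻ ω, ENNReal.ofReal (exp (2 * f ω)) ∂μ ≤ ENNReal.ofReal (exp (2 * A)))
    (hB : ∫⁻ ω, ENNReal.ofReal (exp (2 * g ω)) ∂μ ≤ ENNReal.ofReal (exp (2 * B))) :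
    ∫⁻ ω, ENNReal.ofReal (exp (f ω + g ω)) ∂μ ≤ ENNReal.ofReal (exp (A + B)) := by
  have hpt : ∀ ω, ENNReal.ofReal (exp (f ω + g ω)) ≤
      ENNReal.ofReal (exp (B - A) / 2) * ENNReal.ofReal (exp (2 * f ω)) +
      ENNReal.ofReal (exp (A - B) / 2) * ENNReal.ofReal (exp (2 * g ω)) := by
    intro ω
    rw [← ENNReal.ofReal_mul (by positivity), ← ENNReal.ofReal_mul (by positivity),
      ← ENNReal.ofReal_add (by positivity) (by positivity)]
    apply ENNReal.ofReal_le_ofReal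
    have h1 : exp (B - A) / 2 * exp (2 * f ω) = exp ((B - A) / 2 + f ω) ^ 2 / 2 := by
      rw [← exp_nat_mul, div_mul_eq_mul_div, ← exp_add]; congr 2; push_cast; ring
    have h2 : exp (A - B) / 2 * exp (2 * g ω) = exp ((A - B) / 2 + g ω) ^ 2 / 2 := by
      rw [← exp_nat_mul, div_mul_eq_mul_div, ← exp_add]; congr 2; push_cast; ring
    have h3 : exp (f ω + g ω) = exp ((B - A) / 2 + f ω) * exp ((A - B) / 2 + g ω) := by
      rw [← exp_add]; congr 1; ring
    rw [h1, h2, h3]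
    nlinarith [sq_nonneg (exp ((B - A) / 2 + f ω) - exp ((A - B) / 2 + g ω))]
  refine (lintegral_mono hpt).trans ?_
  rw [lintegral_add_left (by fun_prop), lintegral_const_mul _ (by fun_prop),
    lintegral_const_mul _ (by fun_prop)]
  calc _ ≤ ENNReal.ofReal (exp (B - A) / 2) * ENNReal.ofReal (exp (2 * A)) +
      ENNReal.ofReal (exp (A - B) / 2) * ENNReal.ofReal (exp (2 * B)) := by gcongr
    _ = _ := by
      rw [← ENNReal.ofReal_mul (by positivity), ← ENNReal.ofReal_mul (by positivity),
        ← ENNReal.ofReal_add (by positivity) (by positivity), div_mul_eq_mul_div,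
        div_mul_eq_mul_div, ← exp_add, ← exp_add, show B - A + 2 * A = A + B by ring,
        show A - B + 2 * B = A + B by ring, add_halves]

lemma lintegral_exp_shift_chaos_le {d : ℕ} [NeZero d] (t : Fin d) (ht : t ≠ 0) (c : Fin d → ℝ)
    (s : ℝ) :
    ∫⁻ D, ENNReal.ofReal (exp (s * ∑ j, c j * (D j * D (j + t)))) ∂(radPi d) ≤
      ENNReal.ofReal (exp (s ^ 2 * ∑ j, c j ^ 2)) := by
  set T : Finset (Fin d) := Finset.univ.filter fun j => j < j + t with hT
  have hsplit : ∀ f : Fin d → ℝ, ∑ j, f j = ∑ j ∈ T, f j + ∑ j ∈ Tᶜ, f j := fun f =>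
    (Finset.sum_add_sum_compl T f).symm
  have hshift : ∀ f : Fin d → ℝ, ∑ j ∈ T, f j =
      ∑ i ∈ Finset.univ.filter (fun i => i - t < i), f (i - t) := by
    intro f
    refine Finset.sum_nbij' (fun j => j + t) (fun i => i - t) ?_ ?_ ?_ ?_ ?_ <;> simp [hT]
  have h1 := lintegral_exp_forest_le (fun i => i - t) (fun i => 2 * s * c (i - t))
    (Finset.univ.filter (fun i => i - t < i)) (by simp)
  have h2 := lintegral_exp_forest_le (fun i => i + t) (fun i => 2 * s * c i) Tᶜ (by
    intro i hi
    simp only [hT, Finset.compl_filter, Finset.mem_filter, Finset.mem_univ, true_and, not_lt] at hi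
    exact lt_of_le_of_ne hi (by simpa using ht))
  have key := lintegral_exp_add_le (radPi d) (fun D => s * ∑ j ∈ T, c j * (D j * D (j + t)))
    (fun D => s * ∑ j ∈ Tᶜ, c j * (D j * D (j + t))) (by fun_prop) (by fun_prop)
    (A := s ^ 2 * ∑ j ∈ T, c j ^ 2) (B := s ^ 2 * ∑ j ∈ Tᶜ, c j ^ 2) ?_ ?_
  · simp only [hsplit, mul_add]
    exact key
  · have e1 : ∀ D : Fin d → ℝ, 2 * (s * ∑ j ∈ T, c j * (D j * D (j + t))) =
        ∑ i ∈ Finset.univ.filter (fun i => i - t < i), 2 * s * c (i - t) * (D i * D (i - t)) := by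
      intro D
      rw [hshift (fun j => c j * (D j * D (j + t))), Finset.mul_sum, Finset.mul_sum]
      refine Finset.sum_congr rfl fun i _ => ?_
      rw [sub_add_cancel]; ring
    have e2 : 2 * (s ^ 2 * ∑ j ∈ T, c j ^ 2) =
        ∑ i ∈ Finset.univ.filter (fun i => i - t < i), (2 * s * c (i - t)) ^ 2 / 2 := by
      rw [hshift (fun j => c j ^ 2), Finset.mul_sum, Finset.mul_sum]
      refine Finset.sum_congr rfl fun i _ => ?_
      ring
    simp only [e1, e2]
    exact h1
  · have e1 : ∀ D : Fin d → ℝ, 2 * (s * ∑ j ∈ Tᶜ, c j * (D j * D (j + t))) =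
        ∑ i ∈ Tᶜ, 2 * s * c i * (D i * D (i + t)) := by
      intro D
      rw [Finset.mul_sum, Finset.mul_sum]
      refine Finset.sum_congr rfl fun i _ => ?_
      ring
    have e2 : 2 * (s ^ 2 * ∑ j ∈ Tᶜ, c j ^ 2) = ∑ i ∈ Tᶜ, (2 * s * c i) ^ 2 / 2 := by
      rw [Finset.mul_sum, Finset.mul_sum]
      refine Finset.sum_congr rfl fun i _ => ?_
      ring
    simp only [e1, e2]
    exact h2

lemma measure_ge_le_of_lintegral_exp {Ω : Type*} [MeasurableSpace Ω] (μ : Measure Ω)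
    (f : Ω → ℝ) (hf : Measurable f) (a b : ℝ)
    (h : ∫⁻ ω, ENNReal.ofReal (exp (f ω)) ∂μ ≤ ENNReal.ofReal (exp b)) :
    μ {ω | a ≤ f ω} ≤ ENNReal.ofReal (exp (b - a)) := by
  have h1 : μ {ω | a ≤ f ω} ≤ ∫⁻ ω, ENNReal.ofReal (exp (-a)) * ENNReal.ofReal (exp (f ω)) ∂μ := by
    refine meas_le_lintegral₀ (by fun_prop) fun ω hω => ?_
    rw [← ENNReal.ofReal_mul (exp_pos _).le, ← exp_add, ENNReal.one_le_ofReal, one_le_exp_iff]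
    have : a ≤ f ω := hω
    linarith
  refine h1.trans ?_
  rw [lintegral_const_mul _ (by fun_prop), sub_eq_add_neg, add_comm b, exp_add,
    ENNReal.ofReal_mul (exp_pos _).le]
  gcongr

lemma shift_chaos_tail {d : ℕ} [NeZero d] (t : Fin d) (ht : t ≠ 0) (c : Fin d → ℝ)
    {σ δ : ℝ} (hσ : 0 < σ) (hδ : 0 ≤ δ) (hc : ∑ j, c j ^ 2 ≤ σ ^ 2) :
    radPi d {D | δ ≤ |∑ j, c j * (D j * D (j + t))|} ≤
      ENNReal.ofReal (2 * exp (-(δ ^ 2 / (4 * σ ^ 2)))) := by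
  have key : ∀ c : Fin d → ℝ, ∑ j, c j ^ 2 ≤ σ ^ 2 →
      radPi d {D | δ ≤ ∑ j, c j * (D j * D (j + t))} ≤
        ENNReal.ofReal (exp (-(δ ^ 2 / (4 * σ ^ 2)))) := by
    intro c hc
    set s := δ / (2 * σ ^ 2) with hs
    have hs0 : 0 ≤ s := by positivity
    have h1 := measure_ge_le_of_lintegral_exp (radPi d)
      (fun D => s * ∑ j, c j * (D j * D (j + t))) (by fun_prop) (s * δ) (s ^ 2 * σ ^ 2)
      ((lintegral_exp_shift_chaos_le t ht c s).trans (by gcongr))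
    refine (measure_mono ?_).trans (h1.trans (le_of_eq ?_))
    · intro D hD
      exact mul_le_mul_of_nonneg_left hD hs0
    · congr 2
      rw [hs]; field_simp; ring
  have h2 : {D : Fin d → ℝ | δ ≤ |∑ j, c j * (D j * D (j + t))|} ⊆
      {D | δ ≤ ∑ j, c j * (D j * D (j + t))} ∪ {D | δ ≤ ∑ j, (-c j) * (D j * D (j + t))} := by
    intro D hD
    rcases le_abs.1 (show δ ≤ |∑ j, c j * (D j * D (j + t))| from hD) with h | h
    · exact Or.inl h
    · right
      simpa [neg_mul, Finset.sum_neg_distrib] using h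
  refine (measure_mono h2).trans ((measure_union_le _ _).trans ?_)
  rw [two_mul, ENNReal.ofReal_add (by positivity) (by positivity)]
  exact add_le_add (key c hc) (key (fun j => -c j) (by simpa using hc))

lemma exp_le_one_add_add_sq {x : ℝ} (hx : |x| ≤ 1) : exp x ≤ 1 + x + x ^ 2 := by
  have h := (abs_le.1 (Real.abs_exp_sub_one_sub_id_le hx)).2
  linarith

lemma lintegral_exp_indicator_le {E : Type*} [MeasurableSpace E] (ν : Measure E)
    [IsProbabilityMeasure ν] {A : Set E} (hA : MeasurableSet A) {s : ℝ} (hs : |s| ≤ 1) :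
    ∫⁻ z, ENNReal.ofReal (exp (s * (A.indicator (1 : E → ℝ) z - ν.real A))) ∂ν ≤
      ENNReal.ofReal (exp (s ^ 2 * (ν.real A * (1 - ν.real A)))) := by
  set p := ν.real A with hp
  have hp0 : 0 ≤ p := measureReal_nonneg
  have hp1 : p ≤ 1 := measureReal_le_one
  have e1 : ν A = ENNReal.ofReal p := by rw [hp, ofReal_measureReal]
  have e2 : ν Aᶜ = ENNReal.ofReal (1 - p) := by
    rw [hp, ← probReal_compl_eq_one_sub hA, ofReal_measureReal]
  have i1 : ∫⁻ z in A, ENNReal.ofReal (exp (s * (A.indicator (1 : E → ℝ) z - p))) ∂ν =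
      ENNReal.ofReal (exp (s * (1 - p))) * ν A := by
    rw [← setLIntegral_const]
    refine setLIntegral_congr_fun hA fun z hz => ?_
    simp [hz]
  have i2 : ∫⁻ z in Aᶜ, ENNReal.ofReal (exp (s * (A.indicator (1 : E → ℝ) z - p))) ∂ν =
      ENNReal.ofReal (exp (s * (0 - p))) * ν Aᶜ := by
    rw [← setLIntegral_const]
    refine setLIntegral_congr_fun hA.compl fun z hz => ?_
    have hz' : z ∉ A := hz
    simp [hz']
  rw [← lintegral_add_compl _ hA, i1, i2, e1, e2, ← ENNReal.ofReal_mul (exp_pos _).le,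
    ← ENNReal.ofReal_mul (exp_pos _).le,
    ← ENNReal.ofReal_add (by positivity) (mul_nonneg (exp_pos _).le (by linarith))]
  apply ENNReal.ofReal_le_ofReal
  have b1 : exp (s * (1 - p)) ≤ 1 + s * (1 - p) + (s * (1 - p)) ^ 2 := by
    apply exp_le_one_add_add_sq
    rw [abs_mul, abs_of_nonneg (by linarith : 0 ≤ 1 - p)]
    nlinarith [abs_nonneg s]
  have b2 : exp (s * (0 - p)) ≤ 1 + s * (0 - p) + (s * (0 - p)) ^ 2 := by
    apply exp_le_one_add_add_sq
    rw [abs_mul, zero_sub, abs_neg, abs_of_nonneg hp0]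
    nlinarith [abs_nonneg s]
  have b3 := add_one_le_exp (s ^ 2 * (p * (1 - p)))
  have b4 := mul_le_mul_of_nonneg_right b1 hp0
  have b5 := mul_le_mul_of_nonneg_right b2 (by linarith : 0 ≤ 1 - p)
  nlinarith

/-- One-sided Chernoff bound for the number of hits of a set; `s` may have either sign. -/
lemma chernoff_one_sided {E ι : Type*} [Fintype ι] [MeasurableSpace E] (ν : Measure E)
    [IsProbabilityMeasure ν] {A : Set E} (hA : MeasurableSet A) {s : ℝ} (hs : |s| ≤ 1) (η : ℝ) :
    (Measure.pi fun _ : ι => ν) {z | |s| * (Fintype.card ι * η) ≤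
        s * ∑ i, (A.indicator (1 : E → ℝ) (z i) - ν.real A)} ≤
      ENNReal.ofReal (exp (Fintype.card ι * (s ^ 2 * (ν.real A * (1 - ν.real A)) - |s| * η))) := by
  have hm : Measurable fun z : E => s * (A.indicator (1 : E → ℝ) z - ν.real A) :=
    ((measurable_one.indicator hA).sub_const _).const_mul _
  refine (measure_ge_le_of_lintegral_exp _ (fun z : ι → E => s * ∑ i,
    (A.indicator (1 : E → ℝ) (z i) - ν.real A)) ?_ _
    (Fintype.card ι * (s ^ 2 * (ν.real A * (1 - ν.real A)))) ?_).trans (le_of_eq ?_)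
  · simp only [Finset.mul_sum]
    exact Finset.measurable_sum _ fun i _ => hm.comp (measurable_pi_apply i)
  · have e : ∀ z : ι → E, ENNReal.ofReal (exp (s * ∑ i,
        (A.indicator (1 : E → ℝ) (z i) - ν.real A))) =
        ∏ i, ENNReal.ofReal (exp (s * (A.indicator (1 : E → ℝ) (z i) - ν.real A))) := by
      intro z
      rw [Finset.mul_sum, exp_sum, ENNReal.ofReal_prod_of_nonneg fun i _ => (exp_pos _).le]
    simp only [e]
    rw [lintegral_pi_prod (fun _ : ι => ν)
      (fun _ z => ENNReal.ofReal (exp (s * (A.indicator (1 : E → ℝ) z - ν.real A))))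
      (fun i => (measurable_exp.comp hm).ennreal_ofReal)]
    refine (Finset.prod_le_prod' fun i _ => lintegral_exp_indicator_le ν hA hs).trans ?_
    rw [Finset.prod_const, ← ENNReal.ofReal_pow (exp_pos _).le, ← exp_nat_mul, Finset.card_univ]
  · congr 2; ring

lemma chernoff_two_sided {E ι : Type*} [Fintype ι] [MeasurableSpace E] (ν : Measure E)
    [IsProbabilityMeasure ν] {A : Set E} (hA : MeasurableSet A) {s : ℝ} (hs0 : 0 < s)
    (hs : s ≤ 1) (η : ℝ) :
    (Measure.pi fun _ : ι => ν) {z | Fintype.card ι * η ≤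
        |∑ i, (A.indicator (1 : E → ℝ) (z i) - ν.real A)|} ≤
      ENNReal.ofReal (2 * exp (Fintype.card ι *
        (s ^ 2 * (ν.real A * (1 - ν.real A)) - s * η))) := by
  have h1 := chernoff_one_sided (ι := ι) ν hA (s := s) (by rwa [abs_of_pos hs0]) η
  have h2 := chernoff_one_sided (ι := ι) ν hA (s := -s) (by rwa [abs_neg, abs_of_pos hs0]) η
  rw [abs_neg, neg_sq] at h2
  rw [abs_of_pos hs0] at h1 h2
  rw [two_mul, ENNReal.ofReal_add (exp_pos _).le (exp_pos _).le]
  refine le_trans (measure_mono ?_) ((measure_union_le _ _).trans (add_le_add h1 h2))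
  intro z hz
  rw [Set.mem_ofPred_eq, le_abs] at hz
  rcases hz with h | h
  · exact Or.inl (mul_le_mul_of_nonneg_left h hs0.le)
  · refine Or.inr ?_
    have := mul_le_mul_of_nonneg_left h hs0.le
    rw [Set.mem_ofPred_eq]
    linarith

lemma measurable_sgn : Measurable sgn :=
  Measurable.ite measurableSet_Ici measurable_const measurable_const

lemma gaussian_prod_eq_withDensity :
    (gaussianReal 0 1).prod (gaussianReal 0 1) =
      (volume : Measure (ℝ × ℝ)).withDensity fun p => gaussianPDF 0 1 p.1 * gaussianPDF 0 1 p.2 := by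
  rw [gaussianReal_of_var_ne_zero 0 one_ne_zero,
    prod_withDensity (measurable_gaussianPDF 0 1) (measurable_gaussianPDF 0 1)]
  rfl

/-- The standard Gaussian measure of a planar cone, in terms of its set of angles. -/
lemma gaussian_prod_cone {C : Set (ℝ × ℝ)} (hC : MeasurableSet C) {S : Set ℝ}
    (hS : MeasurableSet S)
    (h : ∀ r φ : ℝ, 0 < r → ((r * cos φ, r * sin φ) ∈ C ↔ φ ∈ S)) :
    ((gaussianReal 0 1).prod (gaussianReal 0 1)) C =
      (ENNReal.ofReal (2 * π))⁻¹ * volume (S ∩ Set.Ioo (-π) π) := by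
  set c : ℝ≥0∞ := ∫⁻ r in Set.Ioi (0 : ℝ), ENNReal.ofReal (r * ((2 * π)⁻¹ * exp (-r ^ 2 / 2))) with hc
  have key : ∀ (C : Set (ℝ × ℝ)) (S : Set ℝ), MeasurableSet C → MeasurableSet S →
      (∀ r φ : ℝ, 0 < r → ((r * cos φ, r * sin φ) ∈ C ↔ φ ∈ S)) →
      ((gaussianReal 0 1).prod (gaussianReal 0 1)) C = c * volume (S ∩ Set.Ioo (-π) π) := by
    intro C S hC hS h
    rw [gaussian_prod_eq_withDensity, withDensity_apply _ hC, ← lintegral_indicator hC,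
      ← lintegral_comp_polarCoord_symm]
    have e1 : ∀ p ∈ polarCoord.target, ENNReal.ofReal p.1 •
        C.indicator (fun p : ℝ × ℝ => gaussianPDF 0 1 p.1 * gaussianPDF 0 1 p.2)
          (polarCoord.symm p) =
        ENNReal.ofReal (p.1 * ((2 * π)⁻¹ * exp (-p.1 ^ 2 / 2))) * S.indicator 1 p.2 := by
      rintro ⟨r, φ⟩ hp
      have hr : 0 < r := hp.1
      simp only [polarCoord_symm_apply, smul_eq_mul]
      by_cases hφ : φ ∈ S
      · rw [Set.indicator_of_mem ((h r φ hr).2 hφ), Set.indicator_of_mem hφ, Pi.one_apply, mul_one,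
          gaussianPDF, gaussianPDF, ← ENNReal.ofReal_mul (gaussianPDFReal_nonneg _ _ _),
          ← ENNReal.ofReal_mul hr.le]
        congr 2
        simp only [gaussianPDFReal, NNReal.coe_one, mul_one, sub_zero]
        rw [mul_mul_mul_comm, ← exp_add, ← mul_inv, Real.mul_self_sqrt (by positivity)]
        congr 2
        have := sin_sq_add_cos_sq φ
        field_simp
        nlinarith
      · rw [Set.indicator_of_notMem (fun hh => hφ ((h r φ hr).1 hh)),
          Set.indicator_of_notMem hφ, mul_zero, mul_zero]
    rw [setLIntegral_congr_fun polarCoord.open_target.measurableSet e1]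
    have e2 : (volume : Measure (ℝ × ℝ)).restrict polarCoord.target =
        (volume.restrict (Set.Ioi (0 : ℝ))).prod (volume.restrict (Set.Ioo (-π) π)) := by
      rw [Measure.prod_restrict]; rfl
    rw [e2, lintegral_prod_mul (f := fun r => ENNReal.ofReal (r * ((2 * π)⁻¹ * exp (-r ^ 2 / 2))))
      (by fun_prop) ((measurable_one.indicator hS).aemeasurable)]
    rw [lintegral_indicator_one hS, Measure.restrict_apply hS]
  have h1 := key Set.univ Set.univ .univ .univ (by simp)
  rw [measure_univ, Set.univ_inter, Real.volume_Ioo, sub_neg_eq_add, ← two_mul] at h1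
  rw [key C S hC hS h, ENNReal.eq_inv_of_mul_eq_one_left h1.symm]

lemma sgn_ne_sgn_iff (a b : ℝ) : sgn a ≠ sgn b ↔ ¬(0 ≤ a ↔ 0 ≤ b) := by
  by_cases ha : 0 ≤ a <;> by_cases hb : 0 ≤ b <;> simp [sgn, ha, hb] <;> norm_num

lemma measurableSet_sgn_ne {α : Type*} [MeasurableSpace α] {f g : α → ℝ} (hf : Measurable f)
    (hg : Measurable g) : MeasurableSet {p | sgn (f p) ≠ sgn (g p)} :=
  (measurableSet_eq_fun (measurable_sgn.comp hf) (measurable_sgn.comp hg)).compl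

/-- Two standard Gaussians at angle `θ` have different signs with probability `θ / π`. -/
lemma gaussian_prod_sgn_ne {θ : ℝ} (h0 : 0 ≤ θ) (hπ : θ ≤ π) :
    ((gaussianReal 0 1).prod (gaussianReal 0 1)).real
      {p : ℝ × ℝ | sgn p.1 ≠ sgn (cos θ * p.1 + sin θ * p.2)} = θ / π := by
  have hpi := Real.pi_pos
  set S : Set ℝ := {φ | sgn (cos φ) ≠ sgn (cos (φ - θ))} with hS
  have hSm : MeasurableSet S := measurableSet_sgn_ne (by fun_prop) (by fun_prop)
  have hsc : ∀ r x : ℝ, 0 < r → sgn (r * x) = sgn x := by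
    intro r x hr
    simp only [sgn, mul_nonneg_iff_of_pos_left hr]
  rw [measureReal_def, gaussian_prod_cone (S := S)
    (measurableSet_sgn_ne (by fun_prop) (by fun_prop)) hSm]
  · have hvol : volume (S ∩ Set.Ioo (-π) π) = ENNReal.ofReal (2 * θ) := by
      have hae : (S ∩ Set.Ioo (-π) π : Set ℝ) =ᵐ[volume]
          (Set.Ico (-(π / 2)) (θ - π / 2) ∪ (Set.Ioo (π / 2) (min π (θ + π / 2)) ∪
            Set.Ioo (-π) (θ - 3 * (π / 2))) : Set ℝ) := by
        have n1 : ∀ x : ℝ, ∀ᵐ φ ∂(volume : Measure ℝ), φ ≠ x := fun x => by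
          simp [ae_iff]
        filter_upwards [n1 (-(π / 2)), n1 (θ + π / 2), n1 (θ - 3 * (π / 2))] with φ hφ1 hφ2 hφ3
        apply propext
        change (sgn (cos φ) ≠ sgn (cos (φ - θ)) ∧ (-π < φ ∧ φ < π)) ↔
          ((-(π / 2) ≤ φ ∧ φ < θ - π / 2) ∨ ((π / 2 < φ ∧ φ < min π (θ + π / 2)) ∨
            (-π < φ ∧ φ < θ - 3 * (π / 2))))
        rw [lt_min_iff]
        by_cases hφ : -π < φ ∧ φ < π
        · obtain ⟨hl, hr⟩ := hφ
          have c1 : 0 ≤ cos φ ↔ -(π / 2) ≤ φ ∧ φ ≤ π / 2 := by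
            constructor
            · intro h
              by_contra hn
              rcases not_and_or.1 hn with hn | hn
              · have := cos_neg_of_pi_div_two_lt_of_lt (x := -φ) (by linarith) (by linarith)
                rw [cos_neg] at this
                linarith
              · have := cos_neg_of_pi_div_two_lt_of_lt (x := φ) (by linarith) (by linarith)
                linarith
            · intro h
              exact cos_nonneg_of_mem_Icc h
          have c2 : 0 ≤ cos (φ - θ) ↔
              (-(π / 2) ≤ φ - θ ∧ φ - θ ≤ π / 2) ∨ φ - θ ≤ -(3 * (π / 2)) := by
            constructor
            · intro h
              by_contra hn
              rw [not_or, not_le] at hn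
              rcases not_and_or.1 hn.1 with hn' | hn'
              · have := cos_neg_of_pi_div_two_lt_of_lt (x := -(φ - θ)) (by linarith) (by linarith)
                rw [cos_neg] at this
                linarith
              · have := cos_neg_of_pi_div_two_lt_of_lt (x := φ - θ) (by linarith) (by linarith)
                linarith
            · rintro (h | h)
              · exact cos_nonneg_of_mem_Icc h
              · rw [← cos_add_two_pi]
                exact cos_nonneg_of_mem_Icc ⟨by linarith, by linarith⟩
          rw [sgn_ne_sgn_iff, c1, c2]
          have hφ2' := lt_or_gt_of_ne hφ2
          have hφ3' := lt_or_gt_of_ne hφ3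
          constructor
          · rintro ⟨h, -⟩
            by_contra hn
            grind
          · rintro (h | h | h)
            · refine ⟨fun hh => ?_, hl, hr⟩
              rcases hh.1 ⟨h.1, by linarith⟩ with h' | h' <;> grind
            · refine ⟨fun hh => ?_, hl, hr⟩
              have := (hh.2 (Or.inl ⟨by linarith, by linarith [h.2.2]⟩)).2
              linarith
            · refine ⟨fun hh => ?_, hl, hr⟩
              have := (hh.2 (Or.inr (by linarith))).1
              linarith
        · refine ⟨fun h => absurd h.2 hφ, fun h => absurd ?_ hφ⟩
          rcases h with h | h | h
          · exact ⟨by linarith, by linarith⟩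
          · exact ⟨by linarith, h.2.1⟩
          · exact ⟨h.1, by linarith⟩
      rw [measure_congr hae, measure_union, measure_union, Real.volume_Ico, Real.volume_Ioo,
        Real.volume_Ioo]
      · rcases le_total θ (π / 2) with h | h
        · rw [min_eq_right (by linarith), ENNReal.ofReal_of_nonpos (p := θ - 3 * (π / 2) - -π)
            (by linarith), add_zero, ← ENNReal.ofReal_add (by linarith) (by linarith)]
          congr 1; ring
        · rw [min_eq_left (by linarith), ← ENNReal.ofReal_add (by linarith) (by linarith),
            ← ENNReal.ofReal_add (by linarith) (by linarith)]
          congr 1; ring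
      · rw [Set.disjoint_left]
        rintro x ⟨h1, h2⟩ ⟨h3, h4⟩
        linarith
      · exact measurableSet_Ioo
      · rw [Set.disjoint_left]
        rintro x ⟨h1, h2⟩ (⟨h3, h4⟩ | ⟨h3, h4⟩) <;> linarith
      · exact measurableSet_Ioo.union measurableSet_Ioo
    rw [hvol, ENNReal.toReal_mul, ENNReal.toReal_inv, ENNReal.toReal_ofReal (by positivity),
      ENNReal.toReal_ofReal (by positivity)]
    field_simp
  · intro r φ hr
    simp only [hS, Set.mem_ofPred_eq]
    rw [hsc r _ hr, show cos θ * (r * cos φ) + sin θ * (r * sin φ) = r * cos (φ - θ) by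
      rw [cos_sub]; ring, hsc r _ hr]

/-- The `i`-th row of the circulant embedding, as a linear functional of the Gaussian vector. -/
def circRow {d : ℕ} (D a : Fin d → ℝ) (i : Fin d) : Fin d → ℝ :=
  fun m => D (i - m) * a (i - m)

lemma sum_circ_eq_dotp {d : ℕ} [NeZero d] (r D a : Fin d → ℝ) (i : Fin d) :
    ∑ j, r (i - j) * (D j * a j) = dotp r (circRow D a i) := by
  rw [dotp, ← Equiv.sum_comp (Equiv.subLeft i)]
  simp [circRow]

lemma dotp_circRow {d : ℕ} [NeZero d] (D a b : Fin d → ℝ) (i i' : Fin d) :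
    dotp (circRow D a i) (circRow D b i') =
      ∑ j, (a j * b (j + (i' - i))) * (D j * D (j + (i' - i))) := by
  rw [dotp, ← Equiv.sum_comp (Equiv.subLeft i)]
  refine Finset.sum_congr rfl fun j _ => ?_
  simp only [circRow, Equiv.subLeft_apply, sub_sub_cancel]
  rw [show i' - (i - j) = j + (i' - i) by abel]
  ring

lemma dotp_circRow_self {d : ℕ} [NeZero d] {D : Fin d → ℝ} (hD : ∀ i, D i = 1 ∨ D i = -1)
    (a b : Fin d → ℝ) (i : Fin d) :
    dotp (circRow D a i) (circRow D b i) = dotp a b := by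
  rw [dotp_circRow, dotp]
  refine Finset.sum_congr rfl fun j _ => ?_
  rw [sub_self, add_zero]
  rcases hD j with h | h <;> rw [h] <;> ring

lemma dotp_comm {ι : Type*} [Fintype ι] (a b : ι → ℝ) : dotp a b = dotp b a := by
  simp only [dotp, mul_comm]

lemma dotp_circRow_linear {d : ℕ} (r D a b : Fin d → ℝ) (c s : ℝ) (i : Fin d) :
    dotp r (circRow D (fun j => c * a j + s * b j) i) =
      c * dotp r (circRow D a i) + s * dotp r (circRow D b i) := by
  simp only [dotp, circRow, Finset.mul_sum, ← Finset.sum_add_distrib]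
  refine Finset.sum_congr rfl fun j _ => ?_
  ring

/-- With high probability the rows of the embeddings of `a` and `b` are nearly orthogonal. -/
lemma radPi_circRow_dotp_le {d k : ℕ} [NeZero d] (f : Fin k → Fin d)
    (hf : Function.Injective f) (a b : Fin d → ℝ) {σ δ : ℝ} (hσ : 0 < σ) (hδ : 0 ≤ δ)
    (ha : ∑ j, a j ^ 2 ≤ 1) (hb : ∀ j, |b j| ≤ σ) :
    radPi d {D | ∃ i i', i ≠ i' ∧ δ ≤ |dotp (circRow D a (f i)) (circRow D b (f i'))|} ≤
      ENNReal.ofReal (k ^ 2 * (2 * exp (-(δ ^ 2 / (4 * σ ^ 2))))) := by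
  have h1 : {D | ∃ i i', i ≠ i' ∧ δ ≤ |dotp (circRow D a (f i)) (circRow D b (f i'))|} ⊆
      ⋃ q : Fin k × Fin k, {D | q.1 ≠ q.2 ∧
        δ ≤ |dotp (circRow D a (f q.1)) (circRow D b (f q.2))|} := by
    rintro D ⟨i, i', h⟩
    exact Set.mem_iUnion.2 ⟨(i, i'), h⟩
  refine (measure_mono h1).trans ((measure_iUnion_fintype_le _ _).trans ?_)
  have h2 : ∀ q : Fin k × Fin k, radPi d {D | q.1 ≠ q.2 ∧
      δ ≤ |dotp (circRow D a (f q.1)) (circRow D b (f q.2))|} ≤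
      ENNReal.ofReal (2 * exp (-(δ ^ 2 / (4 * σ ^ 2)))) := by
    rintro ⟨i, i'⟩
    by_cases hi : i = i'
    · simp [hi]
    · refine (measure_mono ?_).trans (shift_chaos_tail (f i' - f i)
        (sub_ne_zero.2 fun h => hi (hf h).symm) (fun j => a j * b (j + (f i' - f i))) hσ hδ ?_)
      · rintro D ⟨-, h⟩
        rwa [dotp_circRow] at h
      · calc ∑ j, (a j * b (j + (f i' - f i))) ^ 2 ≤ ∑ j, a j ^ 2 * σ ^ 2 := by
              refine Finset.sum_le_sum fun j _ => ?_
              rw [mul_pow]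
              exact mul_le_mul_of_nonneg_left (sq_le_sq' (abs_le.1 (hb _)).1 (abs_le.1 (hb _)).2)
                (sq_nonneg _)
          _ ≤ σ ^ 2 := by
              rw [← Finset.sum_mul]
              exact mul_le_of_le_one_left (sq_nonneg _) ha
  refine (Finset.sum_le_sum fun q _ => h2 q).trans (le_of_eq ?_)
  rw [Finset.sum_const, nsmul_eq_mul, Finset.card_univ, Fintype.card_prod, Fintype.card_fin,
    ENNReal.ofReal_mul (p := (k : ℝ) ^ 2) (by positivity), ENNReal.ofReal_pow (by positivity),
    ENNReal.ofReal_natCast, Nat.cast_mul, sq (k : ℝ≥0∞)]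

/-- Frobenius distance to the identity of the Gram matrix of two nearly orthogonal families. -/
lemma sum_gram_sub_one_sq_le {κ ν : Type*} [Fintype κ] [DecidableEq κ] [Fintype ν]
    (v w : κ → ν → ℝ) {β β' : ℝ} (hβ : 0 ≤ β) (hβ' : 0 ≤ β')
    (hv1 : ∀ i, dotp (v i) (v i) = 1) (hw1 : ∀ i, dotp (w i) (w i) = 1)
    (hvw0 : ∀ i, dotp (v i) (w i) = 0)
    (hv : ∀ i i', i ≠ i' → |dotp (v i) (v i')| ≤ β)
    (hvw : ∀ i i', i ≠ i' → |dotp (v i) (w i')| ≤ β)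
    (hw : ∀ i i', i ≠ i' → |dotp (w i) (w i')| ≤ β') :
    ∑ p : κ ⊕ κ, ∑ q : κ ⊕ κ, (dotp (Sum.elim v w p) (Sum.elim v w q) -
      if p = q then 1 else 0) ^ 2 ≤ (Fintype.card κ : ℝ) ^ 2 * (3 * β ^ 2 + β' ^ 2) := by
  have key : ∀ (g : κ → κ → ℝ) (b : ℝ), (∀ i i', |g i i'| ≤ b) →
      ∑ i, ∑ i', g i i' ^ 2 ≤ (Fintype.card κ : ℝ) ^ 2 * b ^ 2 := by
    intro g b h
    calc ∑ i, ∑ i', g i i' ^ 2 ≤ ∑ i : κ, ∑ i' : κ, b ^ 2 :=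
          Finset.sum_le_sum fun i _ => Finset.sum_le_sum fun i' _ =>
            sq_le_sq' (abs_le.1 (h i i')).1 (abs_le.1 (h i i')).2
      _ = _ := by simp [sq]; ring
  have k1 := key (fun i i' => dotp (v i) (v i') - if i = i' then 1 else 0) β (fun i i' => by
    by_cases h : i = i'
    · subst h; simpa [hv1] using hβ
    · simpa [h] using hv i i' h)
  have k2 := key (fun i i' => dotp (v i) (w i')) β (fun i i' => by
    by_cases h : i = i'
    · subst h; simpa [hvw0] using hβ
    · exact hvw i i' h)
  have k3 := key (fun i i' => dotp (w i) (v i')) β (fun i i' => by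
    rw [dotp_comm]
    by_cases h : i = i'
    · subst h; simpa [hvw0] using hβ
    · exact hvw i' i (Ne.symm h))
  have k4 := key (fun i i' => dotp (w i) (w i') - if i = i' then 1 else 0) β' (fun i i' => by
    by_cases h : i = i'
    · subst h; simpa [hw1] using hβ'
    · simpa [h] using hw i i' h)
  simp only [Fintype.sum_sum_type, Sum.elim_inl, Sum.elim_inr, Sum.inl.injEq, Sum.inr.injEq,
    reduceCtorEq, if_false, sub_zero, Finset.sum_add_distrib]
  linarith

lemma sum_gram_sub_one_sq_le_of_single {κ ν : Type*} [Fintype κ] [DecidableEq κ] [Fintype ν]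
    (v : κ → ν → ℝ) {β : ℝ} (hβ : 0 ≤ β) (hv1 : ∀ i, dotp (v i) (v i) = 1)
    (hv : ∀ i i', i ≠ i' → |dotp (v i) (v i')| ≤ β) :
    ∑ p, ∑ q, (dotp (v p) (v q) - if p = q then 1 else 0) ^ 2 ≤
      (Fintype.card κ : ℝ) ^ 2 * β ^ 2 := by
  calc ∑ i, ∑ i', (dotp (v i) (v i') - if i = i' then 1 else 0) ^ 2
      ≤ ∑ i : κ, ∑ i' : κ, β ^ 2 := by
        refine Finset.sum_le_sum fun i _ => Finset.sum_le_sum fun i' _ => ?_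
        refine sq_le_sq.2 ?_
        rw [abs_of_nonneg hβ]
        by_cases h : i = i'
        · subst h; simpa [hv1] using hβ
        · simpa [h] using hv i i' h
    _ = _ := by simp [sq]; ring

lemma measurePreserving_sum_to_prod {κ : Type*} [Fintype κ] (μ : Measure ℝ)
    [IsProbabilityMeasure μ] :
    MeasurePreserving (fun (z : κ ⊕ κ → ℝ) i => (z (Sum.inl i), z (Sum.inr i)))
      (Measure.pi fun _ => μ) (Measure.pi fun _ : κ => μ.prod μ) := by
  have h1 := measurePreserving_sumPiEquivProdPi (ι := κ) (ι' := κ) (X := fun _ => ℝ) (fun _ => μ)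
  have h2 := (measurePreserving_arrowProdEquivProdArrow ℝ ℝ κ (fun _ => μ) (fun _ => μ)).symm
  exact h2.comp h1

lemma measurable_count {E ι : Type*} [MeasurableSpace E] [Fintype ι] {A : Set E}
    (hA : MeasurableSet A) (p : ℝ) :
    Measurable fun z : ι → E => ∑ i, (A.indicator (1 : E → ℝ) (z i) - p) :=
  Finset.measurable_sum _ fun i _ =>
    ((measurable_one.indicator hA).comp (measurable_pi_apply i)).sub_const p

/-- Transfer of an exponentially small event to a nearly orthonormal family. -/
lemma gaussPi_le_of_exp_small {d : ℕ} {ι : Type*} [Fintype ι] [DecidableEq ι] (a : ι → Fin d → ℝ)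
    (ha : ∑ i, ∑ j, (dotp (a i) (a j) - if i = j then 1 else 0) ^ 2 ≤ 1 / 4) {S : Set (ι → ℝ)}
    (hS : MeasurableSet S) {M : ℝ}
    (hM : (Measure.pi fun _ : ι => gaussianReal 0 1) S ≤ ENNReal.ofReal (2 * exp (-(2 * M)))) :
    gaussPi d {r | (fun i => dotp r (a i)) ∈ S} ≤ ENNReal.ofReal (2 * exp (-M)) := by
  refine (gaussian_nearly_orthonormal a ha hS (exp_pos M)).trans ?_
  refine (add_le_add (mul_le_mul' le_rfl hM) le_rfl).trans (le_of_eq ?_)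
  rw [← ENNReal.ofReal_mul (by positivity), ← ENNReal.ofReal_add (by positivity) (by positivity)]
  congr 1
  rw [one_div, ← exp_neg, show exp M / 2 * (2 * exp (-(2 * M))) = exp (M + -(2 * M)) by
    rw [exp_add]; ring, show M + -(2 * M) = -M by ring]
  ring

/-- Indicator that two numbers have different signs. -/
def bitDiff (a b : ℝ) : ℝ := |sgn a - sgn b| / 2

lemma bitDiff_eq (a b : ℝ) : bitDiff a b = if (0 ≤ a ↔ 0 ≤ b) then 0 else 1 := by
  by_cases ha : 0 ≤ a <;> by_cases hb : 0 ≤ b <;> simp [bitDiff, sgn, ha, hb] <;> norm_num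

lemma indicator_sgn_ne {α : Type*} (f g : α → ℝ) (x : α) :
    {p | sgn (f p) ≠ sgn (g p)}.indicator (1 : α → ℝ) x = bitDiff (f x) (g x) := by
  rw [bitDiff_eq]
  by_cases h : (0 ≤ f x ↔ 0 ≤ g x)
  · rw [if_pos h, Set.indicator_of_notMem]
    exact fun hh => (sgn_ne_sgn_iff _ _).1 hh h
  · rw [if_neg h, Set.indicator_of_mem, Pi.one_apply]
    exact (sgn_ne_sgn_iff _ _).2 h

lemma gaussPi_sgn_count_tail {d : ℕ} {κ : Type*} [Fintype κ] [DecidableEq κ] (v w : κ → Fin d → ℝ)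
    (hvw : ∑ p : κ ⊕ κ, ∑ q : κ ⊕ κ, (dotp (Sum.elim v w p) (Sum.elim v w q) -
      if p = q then 1 else 0) ^ 2 ≤ 1 / 4) {θ s η M : ℝ} (h0 : 0 ≤ θ) (hπ : θ ≤ π)
    (hs0 : 0 < s) (hs1 : s ≤ 1)
    (hM : Fintype.card κ * (s ^ 2 * (θ / π * (1 - θ / π)) - s * η) ≤ -(2 * M)) :
    gaussPi d {r | Fintype.card κ * η ≤ |∑ i,
        (bitDiff (dotp r (v i)) (cos θ * dotp r (v i) + sin θ * dotp r (w i)) - θ / π)|} ≤ ENNReal.ofReal (2 * exp (-M)) := by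
  set A : Set (ℝ × ℝ) := {p | sgn p.1 ≠ sgn (cos θ * p.1 + sin θ * p.2)} with hA
  have hAm : MeasurableSet A := measurableSet_sgn_ne (by fun_prop) (by fun_prop)
  have hp : ((gaussianReal 0 1).prod (gaussianReal 0 1)).real A = θ / π :=
    gaussian_prod_sgn_ne h0 hπ
  have h := chernoff_two_sided (ι := κ) ((gaussianReal 0 1).prod (gaussianReal 0 1)) hAm hs0 hs1 η
  rw [hp] at h
  set T : Set (κ → ℝ × ℝ) := {z | Fintype.card κ * η ≤
        |∑ i, (A.indicator (1 : ℝ × ℝ → ℝ) (z i) - θ / π)|} with hT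
  have hTm : MeasurableSet T := by
    refine measurableSet_le measurable_const (Measurable.abs ?_)
    exact measurable_count hAm _
  have hmp := measurePreserving_sum_to_prod (κ := κ) (gaussianReal 0 1)
  have h2 := hmp.measure_preimage hTm.nullMeasurableSet
  have h3 := gaussPi_le_of_exp_small (Sum.elim v w) hvw (hmp.measurable hTm) (M := M) (by
    rw [h2]
    refine h.trans (ENNReal.ofReal_le_ofReal ?_)
    gcongr)
  simpa only [hT, hA, Set.mem_preimage, Set.mem_ofPred_eq, Sum.elim_inl, Sum.elim_inr,
    indicator_sgn_ne] using h3

lemma gaussPi_small_count_tail {d : ℕ} {κ : Type*} [Fintype κ] [DecidableEq κ] (v : κ → Fin d → ℝ)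
    (hv : ∑ p, ∑ q, (dotp (v p) (v q) - if p = q then 1 else 0) ^ 2 ≤ 1 / 4) {t η M : ℝ}
    (hM : Fintype.card κ * ((gaussianReal 0 1).real {x | |x| ≤ t} - η) ≤ -(2 * M)) :
    gaussPi d {r | Fintype.card κ * η ≤ ∑ i,
        ({x | |x| ≤ t}.indicator (1 : ℝ → ℝ) (dotp r (v i)) - (gaussianReal 0 1).real {x | |x| ≤ t})} ≤
      ENNReal.ofReal (2 * exp (-M)) := by
  set A : Set ℝ := {x | |x| ≤ t} with hA
  have hAm : MeasurableSet A := measurableSet_le measurable_id.abs measurable_const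
  have h := chernoff_two_sided (ι := κ) (gaussianReal 0 1) hAm one_pos le_rfl η
  set p := (gaussianReal 0 1).real A
  set T : Set (κ → ℝ) := {z | Fintype.card κ * η ≤
        ∑ i, (A.indicator (1 : ℝ → ℝ) (z i) - p)} with hT
  have hTm : MeasurableSet T := by
    refine measurableSet_le measurable_const ?_
    exact measurable_count hAm _
  refine gaussPi_le_of_exp_small v hv hTm (M := M) ?_
  refine (measure_mono fun z hz => ?_).trans (h.trans (ENNReal.ofReal_le_ofReal ?_))
  · rw [hT, Set.mem_ofPred_eq] at hz
    exact hz.trans (le_abs_self _)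
  · gcongr
    refine le_trans ?_ hM
    refine mul_le_mul_of_nonneg_left ?_ (by positivity)
    nlinarith [sq_nonneg p]

lemma gaussianReal_abs_le {t : ℝ} (ht : 0 ≤ t) :
    (gaussianReal 0 1).real {x | |x| ≤ t} ≤ 0.8 * t := by
  have h : gaussianReal 0 1 {x | |x| ≤ t} ≤ ENNReal.ofReal (0.8 * t) := by
    rw [gaussianReal_apply 0 one_ne_zero]
    have e : {x : ℝ | |x| ≤ t} = Set.Icc (-t) t := by ext x; simp [abs_le]
    rw [e]
    calc ∫⁻ x in Set.Icc (-t) t, gaussianPDF 0 1 x ≤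
        ∫⁻ x in Set.Icc (-t) t, ENNReal.ofReal 0.4 := by
          refine lintegral_mono (fun x => ?_)
          rw [gaussianPDF]
          apply ENNReal.ofReal_le_ofReal
          simp only [gaussianPDFReal, NNReal.coe_one, mul_one, sub_zero]
          have h1 : exp (-x ^ 2 / 2) ≤ 1 := by
            rw [exp_le_one_iff]
            nlinarith [sq_nonneg x]
          have h2 : (2.5 : ℝ) ≤ √(2 * π) := by
            apply Real.le_sqrt_of_sq_le
            have := Real.pi_gt_d2
            linarith
          have h3 : (√(2 * π))⁻¹ ≤ 0.4 := by
            rw [inv_le_comm₀ (by positivity) (by norm_num)]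
            norm_num at h2 ⊢
            linarith
          have : 0 ≤ (√(2 * π))⁻¹ := by positivity
          nlinarith [exp_pos (-x ^ 2 / 2)]
      _ = ENNReal.ofReal (0.8 * t) := by
          rw [setLIntegral_const, Real.volume_Icc, ← ENNReal.ofReal_mul (by norm_num)]
          congr 1; ring
  rw [measureReal_def]
  exact ENNReal.toReal_le_of_le_ofReal (by positivity) h

lemma lintegral_exp_mul_gaussianReal (c : ℝ) :
    ∫⁻ x, ENNReal.ofReal (exp (c * x)) ∂(gaussianReal 0 1) = ENNReal.ofReal (exp (c ^ 2 / 2)) := by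
  rw [← ofReal_integral_eq_lintegral_ofReal (integrable_exp_mul_gaussianReal c)
    (ae_of_all _ fun _ => (exp_pos _).le)]
  have h := congrFun (mgf_id_gaussianReal (μ := 0) (v := 1)) c
  simp only [mgf, id, zero_mul, zero_add, NNReal.coe_one, one_mul] at h
  rw [h]

/-- Sub-Gaussian tail of a linear functional of a standard Gaussian vector. -/
lemma gaussPi_dotp_tail {d : ℕ} (z : Fin d → ℝ) {ω t : ℝ} (hω : 0 < ω) (ht : 0 ≤ t)
    (hz : dotp z z ≤ ω ^ 2) :
    gaussPi d {r | t ≤ |dotp r z|} ≤ ENNReal.ofReal (2 * exp (-(t ^ 2 / (2 * ω ^ 2)))) := by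
  have key : ∀ z : Fin d → ℝ, dotp z z ≤ ω ^ 2 → gaussPi d {r | t ≤ dotp r z} ≤
      ENNReal.ofReal (exp (-(t ^ 2 / (2 * ω ^ 2)))) := by
    intro z hz
    set s := t / ω ^ 2 with hs
    have hs0 : 0 ≤ s := by positivity
    have hm : ∫⁻ r, ENNReal.ofReal (exp (s * dotp r z)) ∂(gaussPi d) ≤
        ENNReal.ofReal (exp (s ^ 2 * ω ^ 2 / 2)) := by
      have e : ∀ r : Fin d → ℝ, ENNReal.ofReal (exp (s * dotp r z)) =
          ∏ j, ENNReal.ofReal (exp (s * z j * r j)) := by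
        intro r
        rw [dotp, Finset.mul_sum, exp_sum, ENNReal.ofReal_prod_of_nonneg fun i _ => (exp_pos _).le]
        refine Finset.prod_congr rfl fun j _ => ?_
        congr 2; ring
      simp only [e]
      rw [gaussPi, lintegral_pi_prod (fun _ : Fin d => gaussianReal 0 1)
        (fun j x => ENNReal.ofReal (exp (s * z j * x))) (fun j => by fun_prop)]
      simp only [lintegral_exp_mul_gaussianReal]
      rw [← ENNReal.ofReal_prod_of_nonneg fun i _ => (exp_pos _).le, ← exp_sum]
      apply ENNReal.ofReal_le_ofReal
      rw [exp_le_exp]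
      have : ∑ j, (s * z j) ^ 2 / 2 = s ^ 2 * dotp z z / 2 := by
        rw [dotp, Finset.mul_sum, Finset.sum_div]
        refine Finset.sum_congr rfl fun j _ => ?_
        ring
      rw [this]
      gcongr
    have hmeas : Measurable fun r : Fin d → ℝ => s * dotp r z := by
      unfold dotp; fun_prop
    refine (measure_mono ?_).trans ((measure_ge_le_of_lintegral_exp _ _ hmeas (s * t) _ hm).trans
      (le_of_eq ?_))
    · intro r hr
      exact mul_le_mul_of_nonneg_left hr hs0
    · congr 2
      rw [hs]; field_simp; ring
  have h2 : {r : Fin d → ℝ | t ≤ |dotp r z|} ⊆ {r | t ≤ dotp r z} ∪ {r | t ≤ dotp r (fun j => -z j)} := by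
    intro r hr
    rw [Set.mem_ofPred_eq, le_abs] at hr
    rcases hr with h | h
    · exact Or.inl h
    · right
      simpa [dotp] using h
  refine (measure_mono h2).trans ((measure_union_le _ _).trans ?_)
  rw [two_mul, ENNReal.ofReal_add (by positivity) (by positivity)]
  exact add_le_add (key z hz) (key _ (by simpa [dotp] using hz))

/-- Averages over all cyclic windows control the global average. -/
lemma abs_sum_lt_of_windows {k m : ℕ} [NeZero k] (hm : m ≤ k) (hm0 : 0 < m) (f : Fin k → ℝ) {η : ℝ}
    (h : ∀ a : Fin k, |∑ j : Fin m, f (a + Fin.castLE hm j)| < m * η) :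
    |∑ i, f i| < k * η := by
  have e : ∑ a : Fin k, ∑ j : Fin m, f (a + Fin.castLE hm j) = m * ∑ i, f i := by
    rw [Finset.sum_comm]
    have : ∀ j : Fin m, ∑ a : Fin k, f (a + Fin.castLE hm j) = ∑ i, f i := fun j =>
      Equiv.sum_comp (Equiv.addRight (Fin.castLE hm j)) f
    simp [this]
  have hmr : (0 : ℝ) < m := by exact_mod_cast hm0
  have h1 : (m : ℝ) * |∑ i, f i| < m * (k * η) := by
    calc (m : ℝ) * |∑ i, f i| = |∑ a : Fin k, ∑ j : Fin m, f (a + Fin.castLE hm j)| := by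
          rw [e, abs_mul, abs_of_pos hmr]
      _ ≤ ∑ a : Fin k, |∑ j : Fin m, f (a + Fin.castLE hm j)| := Finset.abs_sum_le_sum_abs _ _
      _ < ∑ a : Fin k, m * η := Finset.sum_lt_sum_of_nonempty Finset.univ_nonempty fun a _ => h a
      _ = m * (k * η) := by simp; ring
  exact lt_of_mul_lt_mul_left h1 hmr.le

/-- Concentration of the normalised Hamming distance by splitting into short windows of nearly
independent bits. -/
lemma gaussPi_sgn_count_tail_windows {d k m : ℕ} [NeZero k] (hm : m ≤ k) (hm0 : 0 < m)
    (v w : Fin k → Fin d → ℝ) {β β' : ℝ} (hβ : 0 ≤ β) (hβ' : 0 ≤ β')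
    (hv1 : ∀ i, dotp (v i) (v i) = 1) (hw1 : ∀ i, dotp (w i) (w i) = 1)
    (hvw0 : ∀ i, dotp (v i) (w i) = 0)
    (hv : ∀ i i', i ≠ i' → |dotp (v i) (v i')| ≤ β)
    (hvw : ∀ i i', i ≠ i' → |dotp (v i) (w i')| ≤ β)
    (hw : ∀ i i', i ≠ i' → |dotp (w i) (w i')| ≤ β')
    (hsmall : (m : ℝ) ^ 2 * (3 * β ^ 2 + β' ^ 2) ≤ 1 / 4)
    {θ s η M : ℝ} (h0 : 0 ≤ θ) (hπ : θ ≤ π) (hs0 : 0 < s) (hs1 : s ≤ 1)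
    (hM : m * (s ^ 2 * (θ / π * (1 - θ / π)) - s * η) ≤ -(2 * M)) :
    gaussPi d {r | k * η ≤ |∑ i,
        (bitDiff (dotp r (v i)) (cos θ * dotp r (v i) + sin θ * dotp r (w i)) - θ / π)|} ≤
      ENNReal.ofReal (k * (2 * exp (-M))) := by
  have hsub : {r | k * η ≤ |∑ i,
        (bitDiff (dotp r (v i)) (cos θ * dotp r (v i) + sin θ * dotp r (w i)) - θ / π)|} ⊆
      ⋃ a : Fin k, {r | (Fintype.card (Fin m) : ℝ) * η ≤ |∑ j : Fin m,
        (bitDiff (dotp r (v (a + Fin.castLE hm j)))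
          (cos θ * dotp r (v (a + Fin.castLE hm j)) + sin θ * dotp r (w (a + Fin.castLE hm j))) -
          θ / π)|} := by
    intro r hr
    by_contra hn
    rw [Set.mem_iUnion, not_exists] at hn
    have := abs_sum_lt_of_windows hm hm0 (fun i =>
      bitDiff (dotp r (v i)) (cos θ * dotp r (v i) + sin θ * dotp r (w i)) - θ / π) (η := η)
      (fun a => by simpa using hn a)
    exact absurd hr (not_le.2 this)
  refine (measure_mono hsub).trans ((measure_iUnion_fintype_le _ _).trans ?_)
  have hinj : ∀ a : Fin k, Function.Injective fun j : Fin m => a + Fin.castLE hm j := by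
    intro a j j' h
    exact Fin.castLE_injective hm (add_left_cancel h)
  have hb : ∀ a : Fin k, gaussPi d {r | (Fintype.card (Fin m) : ℝ) * η ≤ |∑ j : Fin m,
        (bitDiff (dotp r (v (a + Fin.castLE hm j)))
          (cos θ * dotp r (v (a + Fin.castLE hm j)) + sin θ * dotp r (w (a + Fin.castLE hm j))) -
          θ / π)|} ≤ ENNReal.ofReal (2 * exp (-M)) := by
    intro a
    refine gaussPi_sgn_count_tail (fun j => v (a + Fin.castLE hm j))
      (fun j => w (a + Fin.castLE hm j)) ?_ h0 hπ hs0 hs1 (by simpa using hM)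
    refine (sum_gram_sub_one_sq_le _ _ hβ hβ' (fun i => hv1 _) (fun i => hw1 _) (fun i => hvw0 _)
      (fun i i' h => hv _ _ fun hh => h (hinj a hh)) (fun i i' h => hvw _ _ fun hh => h (hinj a hh))
      (fun i i' h => hw _ _ fun hh => h (hinj a hh))).trans ?_
    simpa using hsmall
  refine (Finset.sum_le_sum fun a _ => hb a).trans (le_of_eq ?_)
  rw [Finset.sum_const, nsmul_eq_mul, Finset.card_univ, Fintype.card_fin,
    ENNReal.ofReal_mul (p := (k : ℝ)) (by positivity), ENNReal.ofReal_natCast]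

lemma bitDiff_nonneg (a b : ℝ) : 0 ≤ bitDiff a b := by unfold bitDiff; positivity

lemma bitDiff_le_one (a b : ℝ) : bitDiff a b ≤ 1 := by rw [bitDiff_eq]; split_ifs <;> norm_num

lemma one_sub_bitDiff_le {a b t : ℝ} (h : |a + b| ≤ t) :
    1 - bitDiff a b ≤ {x | |x| ≤ t}.indicator (1 : ℝ → ℝ) a := by
  rw [bitDiff_eq]
  split_ifs with hab
  · rw [Set.indicator_of_mem, Pi.one_apply, sub_zero]
    refine le_trans ?_ h
    by_cases ha : 0 ≤ a
    · rw [abs_of_nonneg ha, abs_of_nonneg (add_nonneg ha (hab.1 ha))]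
      linarith [hab.1 ha]
    · have hb : ¬ 0 ≤ b := fun hb => ha (hab.2 hb)
      rw [abs_of_neg (not_le.1 ha), abs_of_neg (by linarith)]
      linarith
  · rw [sub_self]
    exact Set.indicator_nonneg (fun _ _ => zero_le_one) _

/-- Concentration of the normalised Hamming distance for nearly antipodal points. -/
lemma gaussPi_sgn_count_tail_antipodal {d k : ℕ} [NeZero k] (v y : Fin k → Fin d → ℝ) {β : ℝ}
    (hβ : 0 ≤ β) (hv1 : ∀ i, dotp (v i) (v i) = 1)
    (hv : ∀ i i', i ≠ i' → |dotp (v i) (v i')| ≤ β) (hsmall : (k : ℝ) ^ 2 * β ^ 2 ≤ 1 / 4)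
    {ω t ε θ M : ℝ} (hω : 0 < ω) (ht : 0 ≤ t)
    (hy : ∀ i, dotp (fun j => v i j + y i j) (fun j => v i j + y i j) ≤ ω ^ 2)
    (hθπ : θ ≤ π) (hθ : 1 - θ / π < ε) (hM : k * (1.6 * t - ε) ≤ -(2 * M)) :
    gaussPi d {r | k * ε ≤ |∑ i, (bitDiff (dotp r (v i)) (dotp r (y i)) - θ / π)|} ≤
      ENNReal.ofReal (k * (2 * exp (-(t ^ 2 / (2 * ω ^ 2)))) + 2 * exp (-M)) := by
  set p := (gaussianReal 0 1).real {x | |x| ≤ t} with hp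
  have hpt : p ≤ 0.8 * t := gaussianReal_abs_le ht
  have hk : (0 : ℝ) < k := by exact_mod_cast Nat.pos_of_ne_zero (NeZero.ne k)
  have hsub : {r | k * ε ≤ |∑ i, (bitDiff (dotp r (v i)) (dotp r (y i)) - θ / π)|} ⊆
      (⋃ i : Fin k, {r | t ≤ |dotp r (fun j => v i j + y i j)|}) ∪
      {r | Fintype.card (Fin k) * (ε - p) ≤ ∑ i,
        ({x | |x| ≤ t}.indicator (1 : ℝ → ℝ) (dotp r (v i)) - p)} := by
    intro r hr
    by_contra hn
    rw [Set.mem_union, not_or, Set.mem_iUnion, not_exists] at hn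
    obtain ⟨h1, h2⟩ := hn
    have h3 : ∀ i, 1 - bitDiff (dotp r (v i)) (dotp r (y i)) ≤
        {x | |x| ≤ t}.indicator (1 : ℝ → ℝ) (dotp r (v i)) := by
      intro i
      apply one_sub_bitDiff_le
      have := h1 i
      rw [Set.mem_ofPred_eq, not_le] at this
      simpa only [dotp, mul_add, Finset.sum_add_distrib] using this.le
    have h4 : ∑ i, ({x | |x| ≤ t}.indicator (1 : ℝ → ℝ) (dotp r (v i)) - p) < k * (ε - p) := by
      simpa using h2
    rw [Finset.sum_sub_distrib, Finset.sum_const, Finset.card_univ, Fintype.card_fin,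
      nsmul_eq_mul] at h4
    have h5 := Finset.sum_le_sum fun i (_ : i ∈ Finset.univ) => h3 i
    have h6 : 0 ≤ ∑ i, (1 - bitDiff (dotp r (v i)) (dotp r (y i))) :=
      Finset.sum_nonneg fun i _ => sub_nonneg.2 (bitDiff_le_one _ _)
    rw [Finset.sum_sub_distrib, Finset.sum_const, Finset.card_univ, Fintype.card_fin,
      nsmul_eq_mul, mul_one] at h5 h6
    have h7 : 0 ≤ 1 - θ / π := sub_nonneg.2 ((div_le_one Real.pi_pos).2 hθπ)
    have h8 : |∑ i, (bitDiff (dotp r (v i)) (dotp r (y i)) - θ / π)| < k * ε := by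
      rw [Finset.sum_sub_distrib, Finset.sum_const, Finset.card_univ, Fintype.card_fin,
        nsmul_eq_mul, abs_lt]
      constructor <;> nlinarith
    exact absurd hr (not_le.2 h8)
  have hA : gaussPi d (⋃ i : Fin k, {r | t ≤ |dotp r (fun j => v i j + y i j)|}) ≤
      ENNReal.ofReal (k * (2 * exp (-(t ^ 2 / (2 * ω ^ 2))))) := by
    refine (measure_iUnion_fintype_le _ _).trans
      ((Finset.sum_le_sum fun i _ => gaussPi_dotp_tail _ hω ht (hy i)).trans (le_of_eq ?_))
    rw [Finset.sum_const, nsmul_eq_mul, Finset.card_univ, Fintype.card_fin,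
      ENNReal.ofReal_mul (p := (k : ℝ)) (by positivity), ENNReal.ofReal_natCast]
  have hB := gaussPi_small_count_tail v (η := ε - p) (t := t) (M := M)
    ((sum_gram_sub_one_sq_le_of_single v hβ hv1 hv).trans (by simpa using hsmall)) (by
      rw [← hp, Fintype.card_fin]
      refine le_trans ?_ hM
      refine mul_le_mul_of_nonneg_left ?_ hk.le
      linarith)
  refine (measure_mono hsub).trans ((measure_union_le _ _).trans ?_)
  rw [ENNReal.ofReal_add (by positivity) (by positivity)]
  exact add_le_add hA hB

/-- Union bound over an exceptional set of the second coordinate. -/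
lemma prod_le_of_exceptional {α β : Type*} [MeasurableSpace α] [MeasurableSpace β]
    (μ : Measure α) (ν : Measure β) [IsProbabilityMeasure μ] [IsProbabilityMeasure ν]
    {B : Set (α × β)} (hB : MeasurableSet B) (G : Set β) {b₁ b₂ : ℝ≥0∞} (hG : ν G ≤ b₁)
    (h : ∀ᵐ y ∂ν, y ∉ G → μ {x | (x, y) ∈ B} ≤ b₂) : (μ.prod ν) B ≤ b₁ + b₂ := by
  rw [Measure.prod_apply_symm hB]
  calc ∫⁻ y, μ ((fun x => (x, y)) ⁻¹' B) ∂ν ≤ ∫⁻ y, (G.indicator 1 y + b₂) ∂ν := by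
        refine lintegral_mono_ae ?_
        filter_upwards [h] with y hy
        by_cases hyG : y ∈ G
        · rw [Set.indicator_of_mem hyG]
          exact le_add_right prob_le_one
        · rw [Set.indicator_of_notMem hyG, zero_add]
          exact hy hyG
    _ = ∫⁻ y, G.indicator 1 y ∂ν + b₂ := by
        rw [lintegral_add_right _ measurable_const, lintegral_const, measure_univ, mul_one]
    _ ≤ b₁ + b₂ := by
        gcongr
        exact (lintegral_indicator_one_le G).trans hG

lemma measurable_bitDiff {α : Type*} [MeasurableSpace α] {f g : α → ℝ} (hf : Measurable f)
    (hg : Measurable g) : Measurable fun a => bitDiff (f a) (g a) := by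
  unfold bitDiff
  have h1 := measurable_sgn.comp hf
  have h2 := measurable_sgn.comp hg
  exact (h1.sub h2).abs.div_const 2

lemma measurable_dotp_circRow {d : ℕ} (a : Fin d → ℝ) (i : Fin d) :
    Measurable fun ω : (Fin d → ℝ) × (Fin d → ℝ) => dotp ω.1 (circRow ω.2 a i) := by
  unfold dotp circRow
  fun_prop

/-- The event that the normalised Hamming distance deviates from the target by at least `ε`. -/
def deviationSet {d k : ℕ} (e : Fin k → Fin d) (x y : Fin d → ℝ) (θ ε : ℝ) :
    Set ((Fin d → ℝ) × (Fin d → ℝ)) :=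
  {ω | k * ε ≤ |∑ i, (bitDiff (dotp ω.1 (circRow ω.2 x (e i))) (dotp ω.1 (circRow ω.2 y (e i))) -
    θ / π)|}

lemma measurableSet_deviationSet {d k : ℕ} (e : Fin k → Fin d) (x y : Fin d → ℝ) (θ ε : ℝ) :
    MeasurableSet (deviationSet e x y θ ε) := by
  refine measurableSet_le measurable_const (Measurable.abs ?_)
  exact Finset.measurable_sum _ fun i _ =>
    (measurable_bitDiff (measurable_dotp_circRow _ _) (measurable_dotp_circRow _ _)).sub_const _

lemma prod_deviationSet_le {d k m : ℕ} [NeZero d] [NeZero k] (hm : m ≤ k) (hm0 : 0 < m)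
    (e : Fin k → Fin d) (he : Function.Injective e) (x y : Fin d → ℝ)
    (hx : dotp x x = 1) (hy : dotp y y = 1) {θ ρ β s ε M : ℝ} (hθ0 : 0 < θ) (hθπ : θ < π)
    (hxy : dotp x y = cos θ) (hρ : 0 < ρ) (hβ : 0 ≤ β)
    (hxρ : ∀ j, |x j| ≤ ρ) (hyρ : ∀ j, |y j| ≤ ρ)
    (hsmall : (m : ℝ) ^ 2 * (3 * β ^ 2 + (2 * β / sin θ) ^ 2) ≤ 1 / 4)
    (hs0 : 0 < s) (hs1 : s ≤ 1)
    (hM : m * (s ^ 2 * (θ / π * (1 - θ / π)) - s * ε) ≤ -(2 * M)) :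
    ((gaussPi d).prod (radPi d)) (deviationSet e x y θ ε) ≤
      ENNReal.ofReal (3 * (k ^ 2 * (2 * exp (-(β ^ 2 / (4 * ρ ^ 2))))) + k * (2 * exp (-M))) := by
  have hs : 0 < sin θ := sin_pos_of_pos_of_lt_pi hθ0 hθπ
  set w : Fin d → ℝ := fun j => (y j - cos θ * x j) / sin θ with hw
  have hsc := sin_sq_add_cos_sq θ
  have hwexp : ∀ j, cos θ * x j + sin θ * w j = y j := fun j => by
    simp only [hw]; field_simp; ring
  have hxw : dotp x w = 0 := by
    have : dotp x w = (dotp x y - cos θ * dotp x x) / sin θ := by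
      simp only [dotp, hw, Finset.mul_sum, ← Finset.sum_sub_distrib, Finset.sum_div]
      exact Finset.sum_congr rfl fun j _ => by ring
    rw [this, hxy, hx]; simp
  have hww : dotp w w = 1 := by
    have : dotp w w = (dotp y y - 2 * cos θ * dotp x y + cos θ ^ 2 * dotp x x) / sin θ ^ 2 := by
      simp only [dotp, hw, Finset.mul_sum, ← Finset.sum_sub_distrib, ← Finset.sum_add_distrib,
        Finset.sum_div]
      exact Finset.sum_congr rfl fun j _ => by ring
    rw [this, hxy, hx, hy, div_eq_one_iff_eq (by positivity)]
    linarith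
  have hwρ : ∀ j, |w j| ≤ 2 * ρ / sin θ := by
    intro j
    simp only [hw]
    rw [abs_div, abs_of_pos hs]
    gcongr
    calc |y j - cos θ * x j| ≤ |y j| + |cos θ * x j| := abs_sub _ _
      _ ≤ ρ + 1 * ρ := by
          rw [abs_mul]
          gcongr
          · exact hyρ j
          · exact abs_cos_le_one θ
          · exact hxρ j
      _ = 2 * ρ := by ring
  have hsq : ∀ a : Fin d → ℝ, dotp a a = 1 → ∑ j, a j ^ 2 ≤ 1 := fun a ha => by
    rw [← ha]; simp [dotp, sq]
  have t1 := radPi_circRow_dotp_le e he x x hρ hβ (hsq x hx) hxρ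
  have t2 := radPi_circRow_dotp_le e he w x hρ hβ (hsq w hww) hxρ
  have t3 := radPi_circRow_dotp_le e he w w (σ := 2 * ρ / sin θ) (δ := 2 * β / sin θ)
    (by positivity) (by positivity) (hsq w hww) hwρ
  have hE : (2 * β / sin θ) ^ 2 / (4 * (2 * ρ / sin θ) ^ 2) = β ^ 2 / (4 * ρ ^ 2) := by
    field_simp
  rw [hE] at t3
  rw [ENNReal.ofReal_add (by positivity) (by positivity)]
  refine prod_le_of_exceptional _ _ (measurableSet_deviationSet _ _ _ _ _)
    (({D | ∃ i i', i ≠ i' ∧ β ≤ |dotp (circRow D x (e i)) (circRow D x (e i'))|} ∪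
      {D | ∃ i i', i ≠ i' ∧ β ≤ |dotp (circRow D w (e i)) (circRow D x (e i'))|}) ∪
      {D | ∃ i i', i ≠ i' ∧ 2 * β / sin θ ≤ |dotp (circRow D w (e i)) (circRow D w (e i'))|})
    ?_ ?_
  · refine (measure_union_le _ _).trans ((add_le_add ((measure_union_le _ _).trans
      (add_le_add t1 t2)) t3).trans (le_of_eq ?_))
    rw [← ENNReal.ofReal_add (by positivity) (by positivity),
      ← ENNReal.ofReal_add (by positivity) (by positivity)]
    congr 1; ring
  · filter_upwards [ae_radPi d] with D hD hDG
    simp only [Set.mem_union, Set.mem_ofPred_eq, not_or, not_exists, not_and, not_le] at hDG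
    obtain ⟨⟨g1, g2⟩, g3⟩ := hDG
    have h := gaussPi_sgn_count_tail_windows hm hm0 (fun i => circRow D x (e i))
      (fun i => circRow D w (e i)) hβ (by positivity : 0 ≤ 2 * β / sin θ)
      (fun i => by rw [dotp_circRow_self hD, hx]) (fun i => by rw [dotp_circRow_self hD, hww])
      (fun i => by rw [dotp_circRow_self hD, hxw]) (fun i i' hi => (g1 i i' hi).le)
      (fun i i' hi => by rw [dotp_comm]; exact (g2 i' i hi.symm).le)
      (fun i i' hi => (g3 i i' hi).le) hsmall hθ0.le hθπ.le hs0 hs1 hM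
    refine le_trans (le_of_eq ?_) h
    congr 1
    ext r
    simp only [deviationSet, Set.mem_ofPred_eq, ← dotp_circRow_linear, hwexp]

lemma prod_deviationSet_antipodal_le {d k : ℕ} [NeZero d] [NeZero k]
    (e : Fin k → Fin d) (he : Function.Injective e) (x y : Fin d → ℝ)
    (hx : dotp x x = 1) (hy : dotp y y = 1) {θ ρ β ω t ε M : ℝ} (hθπ : θ ≤ π)
    (hxy : dotp x y = cos θ) (hρ : 0 < ρ) (hβ : 0 ≤ β) (hxρ : ∀ j, |x j| ≤ ρ)
    (hsmall : (k : ℝ) ^ 2 * β ^ 2 ≤ 1 / 4) (hω : 0 < ω) (ht : 0 ≤ t)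
    (hθω : 2 + 2 * cos θ ≤ ω ^ 2) (hθ : 1 - θ / π < ε) (hM : k * (1.6 * t - ε) ≤ -(2 * M)) :
    ((gaussPi d).prod (radPi d)) (deviationSet e x y θ ε) ≤
      ENNReal.ofReal (k ^ 2 * (2 * exp (-(β ^ 2 / (4 * ρ ^ 2)))) +
        (k * (2 * exp (-(t ^ 2 / (2 * ω ^ 2)))) + 2 * exp (-M))) := by
  have t1 := radPi_circRow_dotp_le e he x x hρ hβ (by rw [← hx]; simp [dotp, sq]) hxρ
  rw [ENNReal.ofReal_add (by positivity) (by positivity)]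
  refine prod_le_of_exceptional _ _ (measurableSet_deviationSet _ _ _ _ _) _ t1 ?_
  filter_upwards [ae_radPi d] with D hD hDG
  simp only [not_exists, not_and, not_le] at hDG
  refine gaussPi_sgn_count_tail_antipodal (fun i => circRow D x (e i)) (fun i => circRow D y (e i))
    hβ (fun i => by rw [dotp_circRow_self hD, hx]) (fun i i' hi => (hDG i i' hi).le) hsmall hω ht
    (fun i => ?_) hθπ hθ hM
  have e1 : (fun j => circRow D x (e i) j + circRow D y (e i) j) =
      circRow D (fun j => x j + y j) (e i) := by
    ext j; simp [circRow, mul_add]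
  rw [e1, dotp_circRow_self hD]
  have e2 : dotp (fun j => x j + y j) (fun j => x j + y j) = dotp x x + 2 * dotp x y + dotp y y := by
    simp only [dotp, Finset.mul_sum, ← Finset.sum_add_distrib]
    exact Finset.sum_congr rfl fun j _ => by ring
  rw [e2, hx, hy, hxy]
  linarith

lemma nine_le_log_of_params {k N : ℕ} {ε : ℝ} (hε0 : 0 < ε) (hε1 : ε ≤ 1) (hkN : k < N)
    (hk1 : 1 ≤ k) (hk : (k : ℝ) = 144 * log N ^ 2 / ε ^ 2) : 9 ≤ log N := by
  have hN2 : (2 : ℝ) ≤ N := by exact_mod_cast (by omega : 2 ≤ N)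
  have hN0 : (0 : ℝ) < N := by linarith
  have hlow : 144 * log N ^ 2 ≤ k := by
    rw [hk, le_div_iff₀ (by positivity)]
    have : ε ^ 2 ≤ 1 := pow_le_one₀ hε0.le hε1
    nlinarith [sq_nonneg (log N)]
  have hkN' : (k : ℝ) < N := by exact_mod_cast hkN
  have hup : 144 * log N ^ 2 < N := lt_of_le_of_lt hlow hkN'
  have he : exp 1 < 2.7182818286 := exp_one_lt_d9
  have step : ∀ (a : ℝ) (n : ℕ), 0 ≤ a → a ≤ log N → (exp 1) ^ n ≤ 144 * a ^ 2 → (n : ℝ) ≤ log N := by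
    intro a n ha h1 h2
    rw [le_log_iff_exp_le hN0, ← exp_one_pow]
    nlinarith
  have h0 : 0.69 ≤ log N := by
    have := log_le_log (by norm_num) hN2
    linarith [log_two_gt_d9]
  have hp : ∀ n : ℕ, (exp 1) ^ n ≤ (2.7182818286 : ℝ) ^ n := fun n =>
    pow_le_pow_left₀ (exp_pos 1).le he.le n
  have h4 := step 0.69 4 (by norm_num) h0 ((hp 4).trans (by norm_num))
  have h7 := step 4 7 (by norm_num) (by exact_mod_cast h4) ((hp 7).trans (by norm_num))
  have h8 := step 7 8 (by norm_num) (by exact_mod_cast h7) ((hp 8).trans (by norm_num))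
  have h9 := step 8 9 (by norm_num) (by exact_mod_cast h8) ((hp 9).trans (by norm_num))
  exact_mod_cast h9

lemma le_log_of_params {k N : ℕ} {ε : ℝ} (hε0 : 0 < ε) (hε1 : ε ≤ 1) (hℓ : 9 ≤ log N)
    (hN : (0 : ℝ) < N) (hk : (k : ℝ) = 144 * log N ^ 2 / ε ^ 2) :
    27 ≤ log (2 * k * N ^ 2) := by
  have hlow : 144 * 81 ≤ (k : ℝ) := by
    rw [hk, le_div_iff₀ (by positivity)]
    have : ε ^ 2 ≤ 1 := pow_le_one₀ hε0.le hε1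
    nlinarith
  have he : (exp 1) ^ 9 ≤ (2.7182818286 : ℝ) ^ 9 :=
    pow_le_pow_left₀ (exp_pos 1).le exp_one_lt_d9.le 9
  have h9 : 9 ≤ log (2 * k) := by
    rw [le_log_iff_exp_le (by linarith), show (9 : ℝ) = (9 : ℕ) by norm_num, ← exp_one_pow]
    refine he.trans ?_
    norm_num
    linarith
  rw [log_mul (by linarith) (by positivity), log_pow]
  push_cast
  linarith

lemma four_div_sin_sq_le {t : ℝ} (h0 : 0 < t) (h1 : t ≤ π / 2) :
    4 / sin t ^ 2 ≤ π ^ 2 / t ^ 2 := by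
  have hpi := Real.pi_pos
  have hs : 2 / π * t ≤ sin t := mul_le_sin h0.le h1
  have hsin : 0 < sin t := sin_pos_of_pos_of_lt_pi h0 (by linarith)
  rw [div_le_div_iff₀ (by positivity) (by positivity)]
  have h2 : 2 * t ≤ π * sin t := by
    calc 2 * t = π * (2 / π * t) := by field_simp
      _ ≤ _ := mul_le_mul_of_nonneg_left hs hpi.le
  calc 4 * t ^ 2 = (2 * t) ^ 2 := by ring
    _ ≤ (π * sin t) ^ 2 := by gcongr
    _ = π ^ 2 * sin t ^ 2 := by ring

lemma pi_sq_le : π ^ 2 ≤ 9.9 := by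
  calc π ^ 2 ≤ 3.1416 ^ 2 := by gcongr; exact Real.pi_lt_d4.le
    _ ≤ 9.9 := by norm_num

lemma sq_le_of_le_pi_div_two {t : ℝ} (h0 : 0 ≤ t) (h1 : t ≤ π / 2) : t ^ 2 ≤ 2.5 := by
  calc t ^ 2 ≤ (π / 2) ^ 2 := by gcongr
    _ = π ^ 2 / 4 := by ring
    _ ≤ 2.5 := by linarith [pi_sq_le]

lemma pow_four_le_of_le_pi {t : ℝ} (h0 : 0 ≤ t) (h1 : t ≤ π) : t ^ 4 ≤ 98.1 := by
  calc t ^ 4 = (t ^ 2) ^ 2 := by ring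
    _ ≤ (π ^ 2) ^ 2 := by gcongr
    _ ≤ 9.9 ^ 2 := by gcongr; exact pi_sq_le
    _ ≤ 98.1 := by norm_num

lemma failure_bound_sum_le {k N : ℝ} (hk : 1 ≤ k) (hkN : k ≤ N) (hN : 100 ≤ N) :
    3 * (k ^ 2 * (2 * (1 / (4 * k ^ 2 * N ^ 4)))) +
      (k * (2 * (1 / (50 * N ^ 3))) + 2 * (1 / (50 * N ^ 3))) ≤ 1 / (4 * N ^ 2) := by
  have e1 : 3 * (k ^ 2 * (2 * (1 / (4 * k ^ 2 * N ^ 4)))) = 3 / (2 * N ^ 2) * (1 / N ^ 2) := by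
    field_simp
    norm_num
  have e2 : k * (2 * (1 / (50 * N ^ 3))) + 2 * (1 / (50 * N ^ 3)) =
      (k + 1) / (25 * N) * (1 / N ^ 2) := by
    field_simp
    norm_num
  have e3 : 1 / (4 * N ^ 2) = 1 / 4 * (1 / N ^ 2) := by
    field_simp
  rw [e1, e2, e3, ← add_mul]
  refine mul_le_mul_of_nonneg_right ?_ (by positivity)
  have h1 : 3 / (2 * N ^ 2) ≤ 1 / 10 := by
    rw [div_le_iff₀ (by positivity)]
    nlinarith
  have h2 : (k + 1) / (25 * N) ≤ 1 / 10 := by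
    rw [div_le_iff₀ (by positivity)]
    linarith
  linarith

set_option maxHeartbeats 1000000 in
lemma exists_window_params {k : ℕ} {ℓ L ε θ : ℝ} (hε0 : 0 < ε) (hε1 : ε ≤ 1) (hk1 : 1 ≤ k)
    (hkε : k * ε ^ 2 = 144 * ℓ ^ 2) (hℓ : 9 ≤ ℓ) (hL : 27 ≤ L) (hθ0 : 0 < θ)
    (hθ : θ ≤ π / 2 ∨ 0.6 * ε / ℓ ≤ π - θ) :
    θ < π ∧ ∃ (m : ℕ) (s : ℝ), m ≤ k ∧ 0 < m ∧ 0 < s ∧ s ≤ 1 ∧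
      m * (s ^ 2 * (θ / π * (1 - θ / π)) - s * ε) ≤ -(7 * ℓ) ∧
      (m : ℝ) ^ 2 * (θ ^ 4 / (32 * k ^ 2 * L)) * (3 + 4 / sin θ ^ 2) ≤ 1 / 4 := by
  have hpi := Real.pi_pos
  have hpi1 := Real.pi_gt_d2
  have hpi2 : π < 3.1416 := Real.pi_lt_d4
  have hkr : (1 : ℝ) ≤ k := by exact_mod_cast hk1
  have hθπ : θ < π := by
    rcases hθ with h | h
    · linarith
    · have : 0 < 0.6 * ε / ℓ := by positivity
      linarith
  refine ⟨hθπ, ?_⟩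
  have hsin : 0 < sin θ := sin_pos_of_pos_of_lt_pi hθ0 hθπ
  rcases le_or_gt θ (π / 2) with h2 | h2
  · refine ⟨k, ε, le_rfl, hk1, hε0, hε1, ?_, ?_⟩
    · have : θ / π * (1 - θ / π) ≤ 1 / 4 := by nlinarith [sq_nonneg (θ / π - 1 / 2)]
      have h1 : (k : ℝ) * (ε ^ 2 * (θ / π * (1 - θ / π)) - ε * ε) =
        k * ε ^ 2 * (θ / π * (1 - θ / π) - 1) := by ring
      rw [h1, hkε]
      nlinarith
    · have h4 := four_div_sin_sq_le hθ0 h2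
      have e : (k : ℝ) ^ 2 * (θ ^ 4 / (32 * k ^ 2 * L)) = θ ^ 4 / (32 * L) := by field_simp
      rw [e]
      have hθ2 := sq_le_of_le_pi_div_two hθ0.le h2
      calc θ ^ 4 / (32 * L) * (3 + 4 / sin θ ^ 2) ≤ θ ^ 4 / (32 * L) * (3 + π ^ 2 / θ ^ 2) := by
            gcongr
        _ = (3 * (θ ^ 2) ^ 2 + π ^ 2 * θ ^ 2) / (32 * L) := by field_simp
        _ ≤ 1 / 4 := by
            rw [div_le_iff₀ (by positivity)]
            have h5 : (θ ^ 2) ^ 2 ≤ 2.5 ^ 2 := by gcongr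
            have h6 : π ^ 2 * θ ^ 2 ≤ 9.9 * 2.5 := by
              gcongr
              exact pi_sq_le
            linarith
  · have hθ' : 0.6 * ε / ℓ ≤ π - θ := hθ.resolve_left (not_le.2 h2)
    set τ := π - θ with hτ
    have hτ0 : 0 < τ := by linarith
    have hτ2 : τ ≤ π / 2 := by linarith
    set q := τ / π with hq
    have hq0 : 0 < q := by positivity
    have hτq : τ = π * q := by rw [hq]; field_simp
    have hpq : θ / π = 1 - q := by rw [hq, hτ]; field_simp; ring
    have hv : θ / π * (1 - θ / π) ≤ q := by rw [hpq]; nlinarith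
    have hX1 : 1 ≤ 0.34 * k * τ := by
      have h1 : 0.6 * ε ≤ τ * ℓ := by rwa [div_le_iff₀ (by linarith)] at hθ'
      have h2 : 0.6 * ε * (k * ε) ≤ τ * ℓ * (k * ε) := mul_le_mul_of_nonneg_right h1 (by positivity)
      have h3 : 0.6 * (144 * ℓ ^ 2) ≤ τ * ℓ * (k * ε) := by rw [← hkε]; linarith
      have h4 : 0.6 * (144 * ℓ) ≤ τ * (k * ε) := by
        refine le_of_mul_le_mul_right ?_ (by linarith : 0 < ℓ)
        linarith
      have h5 : τ * (k * ε) ≤ τ * k * 1 := by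
        rw [← mul_assoc]
        exact mul_le_mul_of_nonneg_left hε1 (by positivity)
      nlinarith
    set m := ⌊0.34 * k * τ⌋₊ with hm
    have hm1 : 1 ≤ m := Nat.le_floor (by simpa using hX1)
    have hmr : (1 : ℝ) ≤ m := by exact_mod_cast hm1
    have hmle : (m : ℝ) ≤ 0.34 * k * τ := Nat.floor_le (by positivity)
    have hmge : 0.17 * k * τ ≤ m := by
      have := Nat.lt_floor_add_one (0.34 * k * τ)
      rw [← hm] at this
      linarith
    have hmk : m ≤ k := by
      have : (m : ℝ) ≤ k := by
        refine hmle.trans ?_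
        nlinarith
      exact_mod_cast this
    have hsmall : (m : ℝ) ^ 2 * (θ ^ 4 / (32 * k ^ 2 * L)) * (3 + 4 / sin θ ^ 2) ≤ 1 / 4 := by
      have hsτ : sin θ = sin τ := by rw [hτ, sin_pi_sub]
      rw [hsτ] at hsin ⊢
      have h4 := four_div_sin_sq_le hτ0 hτ2
      have hθ4 := pow_four_le_of_le_pi hθ0.le hθπ.le
      have hτ2' := sq_le_of_le_pi_div_two hτ0.le hτ2
      have hpi2' := pi_sq_le
      calc (m : ℝ) ^ 2 * (θ ^ 4 / (32 * k ^ 2 * L)) * (3 + 4 / sin τ ^ 2) ≤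
          (0.34 * k * τ) ^ 2 * (98.1 / (32 * k ^ 2 * 27)) * (3 + π ^ 2 / τ ^ 2) := by gcongr
        _ = 0.34 ^ 2 * (98.1 / (32 * 27)) * (3 * τ ^ 2 + π ^ 2) := by field_simp
        _ ≤ 0.34 ^ 2 * (98.1 / (32 * 27)) * (3 * 2.5 + 9.9) := by gcongr
        _ ≤ 1 / 4 := by norm_num
    rcases le_or_gt ε (2 * q) with hc | hc
    · refine ⟨m, ε / (2 * q), hmk, hm1, by positivity, (div_le_one (by positivity)).2 hc, ?_, hsmall⟩
      have h1 : (ε / (2 * q)) ^ 2 * (θ / π * (1 - θ / π)) - ε / (2 * q) * ε ≤ -(ε ^ 2 / (4 * q)) := by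
        have := mul_le_mul_of_nonneg_left hv (sq_nonneg (ε / (2 * q)))
        have e : (ε / (2 * q)) ^ 2 * q - ε / (2 * q) * ε = -(ε ^ 2 / (4 * q)) := by
          field_simp; ring
        linarith
      refine (mul_le_mul_of_nonneg_left h1 (by linarith)).trans ?_
      have h2 : 7 * ℓ ≤ m * (ε ^ 2 / (4 * q)) := by
        calc 7 * ℓ ≤ 0.17 * 3.14 / 4 * (144 * ℓ ^ 2) := by nlinarith
          _ = 0.17 * 3.14 / 4 * (k * ε ^ 2) := by rw [hkε]
          _ ≤ 0.17 * π / 4 * (k * ε ^ 2) := by gcongr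
          _ = 0.17 * k * τ * (ε ^ 2 / (4 * q)) := by rw [hτq]; field_simp
          _ ≤ _ := by gcongr
      linarith
    · refine ⟨m, 1, hmk, hm1, one_pos, le_rfl, ?_, hsmall⟩
      have h1 : 1 ^ 2 * (θ / π * (1 - θ / π)) - 1 * ε ≤ -(ε / 2) := by linarith
      refine (mul_le_mul_of_nonneg_left h1 (by linarith)).trans ?_
      have h2 : 7 * ℓ ≤ m * (ε / 2) := by
        calc 7 * ℓ ≤ 0.051 * (144 * ℓ ^ 2) / ℓ := by
              rw [le_div_iff₀ (by linarith)]; nlinarith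
          _ = 0.17 * k * (0.6 * ε / ℓ) * (ε / 2) := by rw [← hkε]; ring
          _ ≤ 0.17 * k * τ * (ε / 2) := by gcongr
          _ ≤ _ := by gcongr
      linarith

set_option maxHeartbeats 1000000 in
lemma prod_deviationSet_le_of_params {d k N : ℕ} [NeZero d] [NeZero k] (hkN : k < N)
    (e : Fin k → Fin d) (he : Function.Injective e) (x y : Fin d → ℝ)
    (hx : dotp x x = 1) (hy : dotp y y = 1) {ε θ : ℝ} (hε0 : 0 < ε) (hε1 : ε ≤ 1)
    (hk : (k : ℝ) = 144 * log N ^ 2 / ε ^ 2) (hθ0 : 0 < θ) (hθπ : θ ≤ π)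
    (hxy : dotp x y = cos θ)
    (hxρ : ∀ j, |x j| ≤ θ ^ 2 / (16 * k * log (2 * k * N ^ 2)))
    (hyρ : ∀ j, |y j| ≤ θ ^ 2 / (16 * k * log (2 * k * N ^ 2))) :
    ((gaussPi d).prod (radPi d)) (deviationSet e x y θ ε) ≤ ENNReal.ofReal (1 / (4 * N ^ 2)) := by
  have hk1 : 1 ≤ k := Nat.pos_of_ne_zero (NeZero.ne k)
  have hℓ := nine_le_log_of_params hε0 hε1 hkN hk1 hk
  have hkr : (1 : ℝ) ≤ k := by exact_mod_cast hk1
  have hkN' : (k : ℝ) ≤ N := by exact_mod_cast hkN.le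
  have hN0 : (0 : ℝ) < N := by linarith
  have hL := le_log_of_params hε0 hε1 hℓ hN0 hk
  have hkε : k * ε ^ 2 = 144 * log N ^ 2 := by rw [hk]; field_simp
  set ℓ := log N with hℓdef
  set L := log (2 * k * N ^ 2) with hLdef
  set ρ := θ ^ 2 / (16 * k * L) with hρdef
  set β := √(8 * L) * ρ with hβdef
  have hρ : 0 < ρ := by positivity
  have hβ : 0 ≤ β := by positivity
  have hβ2 : β ^ 2 = 8 * L * ρ ^ 2 := by rw [hβdef, mul_pow, sq_sqrt (by positivity)]
  have hβ2' : β ^ 2 = θ ^ 4 / (32 * k ^ 2 * L) := by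
    rw [hβ2, hρdef]; field_simp; norm_num
  have hexp : β ^ 2 / (4 * ρ ^ 2) = 2 * L := by rw [hβ2]; field_simp; norm_num
  have hE : exp (-(β ^ 2 / (4 * ρ ^ 2))) = 1 / (4 * k ^ 2 * N ^ 4) := by
    rw [hexp, exp_neg, two_mul, exp_add, hLdef, exp_log (by positivity)]
    field_simp; norm_num
  have hN50 : 100 ≤ (N : ℝ) := by
    have h1 : ℓ ≤ 144 * ℓ ^ 2 := by nlinarith
    have h2 : 144 * ℓ ^ 2 ≤ k := by
      rw [← hkε]
      have : ε ^ 2 ≤ 1 := pow_le_one₀ hε0.le hε1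
      nlinarith
    nlinarith
  have hM : exp (-(7 / 2 * ℓ)) ≤ 1 / (50 * N ^ 3) := by
    have h1 : exp (-(7 / 2 * ℓ)) = (exp (ℓ / 2))⁻¹ * (N ^ 3 : ℝ)⁻¹ := by
      rw [← exp_neg, show -(7 / 2 * ℓ) = -(ℓ / 2) + -((3 : ℕ) * ℓ) by push_cast; ring, exp_add,
        exp_neg ((3 : ℕ) * ℓ), exp_nat_mul, hℓdef, exp_log hN0]
    have h2 : 50 ≤ exp (ℓ / 2) := by
      calc (50 : ℝ) ≤ 2.7 ^ 4 := by norm_num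
        _ ≤ exp 1 ^ 4 := by
            gcongr
            linarith [exp_one_gt_d9]
        _ = exp 4 := by rw [exp_one_pow]; norm_num
        _ ≤ exp (ℓ / 2) := by
            rw [exp_le_exp]; linarith
    rw [h1, one_div, mul_inv]
    gcongr
  have hfin := failure_bound_sum_le hkr hkN' hN50
  by_cases hθ : θ ≤ π / 2 ∨ 0.6 * ε / ℓ ≤ π - θ
  · obtain ⟨hθπ', m, s, hmk, hm0, hs0, hs1, hcond, hsmall⟩ :=
      exists_window_params (L := L) hε0 hε1 hk1 hkε hℓ hL hθ0 hθ
    refine (prod_deviationSet_le hmk hm0 e he x y hx hy hθ0 hθπ' hxy hρ hβ hxρ hyρ ?_ hs0 hs1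
      (M := 7 / 2 * ℓ) (hcond.trans (by linarith))).trans (ENNReal.ofReal_le_ofReal ?_)
    · refine le_trans (le_of_eq ?_) hsmall
      rw [div_pow, mul_pow 2 β, hβ2']; ring
    · rw [hE]
      refine le_trans ?_ hfin
      have : 0 ≤ 2 * (1 / (50 * (N : ℝ) ^ 3)) := by positivity
      have : (k : ℝ) * (2 * exp (-(7 / 2 * ℓ))) ≤ k * (2 * (1 / (50 * N ^ 3))) := by gcongr
      linarith
  · rw [not_or, not_le, not_le] at hθ
    obtain ⟨-, hθ'⟩ := hθ
    have hω : 0 < 0.6 * ε / ℓ := by positivity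
    have hpi1 := Real.pi_gt_d2
    refine (prod_deviationSet_antipodal_le e he x y hx hy hθπ hxy hρ hβ hxρ ?_ hω
      (t := 0.55 * ε) (M := 7 / 2 * ℓ) (by positivity) ?_ ?_ ?_).trans (ENNReal.ofReal_le_ofReal ?_)
    · rw [hβ2']
      have e1 : (k : ℝ) ^ 2 * (θ ^ 4 / (32 * k ^ 2 * L)) = θ ^ 4 / (32 * L) := by field_simp
      have hθ4 := pow_four_le_of_le_pi hθ0.le hθπ
      rw [e1, div_le_iff₀ (by positivity)]
      norm_num at hθ4
      linarith
    · have h1 := one_sub_sq_div_two_le_cos (x := π - θ)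
      rw [cos_pi_sub] at h1
      have h2 : (π - θ) ^ 2 ≤ (0.6 * ε / ℓ) ^ 2 := by
        gcongr
      linarith
    · have h1 : 1 - θ / π = (π - θ) / π := by field_simp
      rw [h1, div_lt_iff₀ Real.pi_pos]
      have h2 : 0.6 * ε / ℓ ≤ ε := by
        rw [div_le_iff₀ (by linarith)]; nlinarith
      nlinarith
    · have h1 : (k : ℝ) * (1.6 * (0.55 * ε) - ε) = -(0.12 * (k * ε)) := by ring
      have h2 : (k : ℝ) * ε ^ 2 ≤ k * ε :=
        mul_le_mul_of_nonneg_left (by nlinarith) (by linarith)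
      rw [h1]
      nlinarith
    · rw [hE]
      have h1 : 7 / 2 * ℓ ≤ (0.55 * ε) ^ 2 / (2 * (0.6 * ε / ℓ) ^ 2) := by
        have : (0.55 * ε) ^ 2 / (2 * (0.6 * ε / ℓ) ^ 2) = 0.55 ^ 2 / (2 * 0.6 ^ 2) * ℓ ^ 2 := by
          field_simp
        rw [this]
        nlinarith
      have h2 : exp (-((0.55 * ε) ^ 2 / (2 * (0.6 * ε / ℓ) ^ 2))) ≤ 1 / (50 * N ^ 3) :=
        (exp_le_exp.2 (neg_le_neg h1)).trans hM
      refine le_trans ?_ hfin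
      refine add_le_add ?_ (add_le_add ?_ ?_)
      · have : 0 ≤ (k : ℝ) ^ 2 * (2 * (1 / (4 * k ^ 2 * N ^ 4))) := by positivity
        linarith
      · gcongr
      · gcongr

lemma l2norm_pos {ι : Type*} [Fintype ι] {x : ι → ℝ} (hx : x ≠ 0) : 0 < l2norm x := by
  obtain ⟨i, hi⟩ := Function.ne_iff.1 hx
  refine sqrt_pos.2 (Finset.sum_pos' (fun j _ => sq_nonneg _) ⟨i, Finset.mem_univ _, ?_⟩)
  have : x i ≠ 0 := hi
  positivity

lemma linf_nonneg {ι : Type*} [Fintype ι] (x : ι → ℝ) : 0 ≤ linf x :=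
  Real.iSup_nonneg fun _ => abs_nonneg _

lemma abs_le_linf {ι : Type*} [Fintype ι] (x : ι → ℝ) (i : ι) : |x i| ≤ linf x :=
  le_ciSup (f := fun i => |x i|) (Set.finite_range _).bddAbove i

lemma l2norm_sq {ι : Type*} [Fintype ι] (x : ι → ℝ) : l2norm x ^ 2 = dotp x x := by
  rw [l2norm, sq_sqrt (Finset.sum_nonneg fun _ _ => sq_nonneg _), dotp]
  exact Finset.sum_congr rfl fun _ _ => sq _

lemma abs_dotp_le {ι : Type*} [Fintype ι] (x y : ι → ℝ) : |dotp x y| ≤ l2norm x * l2norm y := by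
  refine abs_le_of_sq_le_sq ?_ (mul_nonneg (sqrt_nonneg _) (sqrt_nonneg _))
  rw [mul_pow, l2norm_sq, l2norm_sq]
  have := Finset.sum_mul_sq_le_sq_mul_sq Finset.univ x y
  simpa only [dotp, sq] using this

lemma dotp_div_div {ι : Type*} [Fintype ι] (x y : ι → ℝ) (a b : ℝ) :
    dotp (fun i => x i / a) (fun i => y i / b) = dotp x y / (a * b) := by
  simp only [dotp, Finset.sum_div]
  exact Finset.sum_congr rfl fun _ _ => by rw [div_mul_div_comm]

lemma cos_angle' {ι : Type*} [Fintype ι] {x y : ι → ℝ} (hx : x ≠ 0) (hy : y ≠ 0) :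
    cos (angle' x y) = dotp x y / (l2norm x * l2norm y) := by
  have hp : 0 < l2norm x * l2norm y := mul_pos (l2norm_pos hx) (l2norm_pos hy)
  have h := abs_le.1 (abs_dotp_le x y)
  rw [angle', cos_arccos]
  · rw [le_div_iff₀ hp]
    linarith
  · rw [div_le_one hp]
    exact h.2

lemma sgn_div_of_pos {t c : ℝ} (hc : 0 < c) : sgn (t / c) = sgn t := by
  simp only [sgn, le_div_iff₀ hc, zero_mul]

lemma cbe_eq {d k : ℕ} [NeZero d] (hk : k ≤ d) (r D x : Fin d → ℝ) {c : ℝ} (hc : 0 < c)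
    (i : Fin k) :
    cbe hk r D x i = sgn (dotp r (circRow D (fun j => x j / c) (Fin.castLE hk i))) := by
  rw [← sum_circ_eq_dotp, cbe, ← sgn_div_of_pos hc, Finset.sum_div]
  congr 1
  refine Finset.sum_congr rfl fun j _ => ?_
  ring

lemma l1norm_cbe_sub {d k : ℕ} [NeZero d] (hk : k ≤ d) (r D x y : Fin d → ℝ) {a b : ℝ}
    (ha : 0 < a) (hb : 0 < b) :
    l1norm (cbe hk r D x - cbe hk r D y) =
      2 * ∑ i, bitDiff (dotp r (circRow D (fun j => x j / a) (Fin.castLE hk i)))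
        (dotp r (circRow D (fun j => y j / b) (Fin.castLE hk i))) := by
  rw [l1norm, Finset.mul_sum]
  refine Finset.sum_congr rfl fun i _ => ?_
  rw [Pi.sub_apply, cbe_eq hk r D x ha, cbe_eq hk r D y hb, bitDiff]
  ring

lemma abs_sub_eq_abs_sum_div {k : ℕ} [NeZero k] (b : Fin k → ℝ) (c : ℝ) :
    |1 / (2 * (k : ℝ)) * (2 * ∑ i, b i) - c| = |∑ i, (b i - c)| / k := by
  have hk : (0 : ℝ) < k := by exact_mod_cast Nat.pos_of_ne_zero (NeZero.ne k)
  rw [← abs_of_pos hk, ← abs_div, abs_of_pos hk, Finset.sum_sub_distrib, Finset.sum_const,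
    Finset.card_univ, Fintype.card_fin, nsmul_eq_mul]
  congr 1
  field_simp

lemma prod_cbe_failure_le {d k N : ℕ} (hk0 : k ≠ 0) (hkd : k < d) (hkN : k < N)
    {x y : Fin d → ℝ} (hx : x ≠ 0) (hy : y ≠ 0) {ε : ℝ} (hε : 0 < ε)
    (hk : (k : ℝ) = 144 * log N ^ 2 / ε ^ 2)
    (hρ : max (linf x / l2norm x) (linf y / l2norm y) <
      angle' x y ^ 2 / (16 * k * log (2 * k * N ^ 2))) :
    ((gaussPi d).prod (radPi d)) {ω | ε ≤ |1 / (2 * (k : ℝ)) *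
      l1norm (cbe hkd.le ω.1 ω.2 x - cbe hkd.le ω.1 ω.2 y) - angle' x y / π|} ≤
      ENNReal.ofReal (1 / (4 * N ^ 2)) := by
  have : NeZero k := ⟨hk0⟩
  have : NeZero d := ⟨by omega⟩
  have hx0 := l2norm_pos hx
  have hy0 := l2norm_pos hy
  have hk' : (0 : ℝ) < k := by exact_mod_cast Nat.pos_of_ne_zero hk0
  have hθπ : angle' x y ≤ π := arccos_le_pi _
  have hθ0 : 0 < angle' x y := by
    refine lt_of_le_of_ne (arccos_nonneg _) fun h => ?_
    rw [← h] at hρ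
    have := (div_nonneg (linf_nonneg x) hx0.le).trans (le_max_left _ (linf y / l2norm y))
    simp only [ne_eq, OfNat.ofNat_ne_zero, not_false_eq_true, zero_pow, zero_div] at hρ
    linarith
  have key : ∀ ω : (Fin d → ℝ) × (Fin d → ℝ), |1 / (2 * (k : ℝ)) *
      l1norm (cbe hkd.le ω.1 ω.2 x - cbe hkd.le ω.1 ω.2 y) - angle' x y / π| =
      |∑ i, (bitDiff (dotp ω.1 (circRow ω.2 (fun j => x j / l2norm x) (Fin.castLE hkd.le i)))
        (dotp ω.1 (circRow ω.2 (fun j => y j / l2norm y) (Fin.castLE hkd.le i))) -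
        angle' x y / π)| / k := fun ω => by
    rw [l1norm_cbe_sub hkd.le ω.1 ω.2 x y hx0 hy0, abs_sub_eq_abs_sum_div]
  rcases le_or_gt ε 1 with hε1 | hε1
  · have hsub : {ω : (Fin d → ℝ) × (Fin d → ℝ) | ε ≤ |1 / (2 * (k : ℝ)) *
        l1norm (cbe hkd.le ω.1 ω.2 x - cbe hkd.le ω.1 ω.2 y) - angle' x y / π|} ⊆
        deviationSet (Fin.castLE hkd.le) (fun j => x j / l2norm x) (fun j => y j / l2norm y)
          (angle' x y) ε := fun ω hω => by
      rw [Set.mem_ofPred_eq, key, le_div_iff₀ hk', mul_comm] at hω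
      exact hω
    have hunit : ∀ {z : Fin d → ℝ}, 0 < l2norm z →
        dotp (fun j => z j / l2norm z) (fun j => z j / l2norm z) = 1 := fun {z} hz => by
      rw [dotp_div_div, ← l2norm_sq, sq, div_self (by positivity)]
    refine (measure_mono hsub).trans (prod_deviationSet_le_of_params hkN _
      (Fin.castLE_injective _) _ _ (hunit hx0) (hunit hy0) hε hε1 hk hθ0 hθπ ?_ ?_ ?_)
    · rw [dotp_div_div, cos_angle' hx hy]
    · intro j
      rw [abs_div, abs_of_pos hx0]
      exact ((div_le_div_of_nonneg_right (abs_le_linf x j) hx0.le).trans (le_max_left _ _)).trans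
        hρ.le
    · intro j
      rw [abs_div, abs_of_pos hy0]
      exact ((div_le_div_of_nonneg_right (abs_le_linf y j) hy0.le).trans (le_max_right _ _)).trans
        hρ.le
  · refine le_of_eq_of_le ?_ zero_le
    convert measure_empty (μ := (gaussPi d).prod (radPi d))
    refine Set.eq_empty_of_forall_notMem fun ω hω => ?_
    rw [Set.mem_ofPred_eq, key, le_div_iff₀ hk'] at hω
    have h1 : ∀ a b : ℝ, |bitDiff a b - angle' x y / π| ≤ 1 := fun a b => by
      have h2 : angle' x y / π ≤ 1 := (div_le_one pi_pos).2 hθπ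
      have h3 : 0 ≤ angle' x y / π := by positivity
      have h4 := bitDiff_nonneg a b
      have h5 := bitDiff_le_one a b
      rw [abs_le]
      constructor <;> linarith
    have h2 := (Finset.abs_sum_le_sum_abs _ _).trans (Finset.sum_le_sum fun i (_ : i ∈ Finset.univ) =>
      h1 (dotp ω.1 (circRow ω.2 (fun j => x j / l2norm x) (Fin.castLE hkd.le i)))
        (dotp ω.1 (circRow ω.2 (fun j => y j / l2norm y) (Fin.castLE hkd.le i))))
    rw [Finset.sum_const, Finset.card_univ, Fintype.card_fin, nsmul_eq_mul, mul_one] at h2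
    nlinarith

/-- **Johnson–Lindenstrauss type corollary for CBE.** For `N` nonzero points `u_i` in `ℝ^d`,
accuracy `ε > 0` and `k = 144 log² N / ε²` with `k < N` and `k < d`, with probability at least
`3/4` (over `r` and `D`), every pair `i, j` with
`ρ_{ij} < θ_{ij}²/(16 k log(2kN²))` satisfies
`|(1/(2k))‖Φ_i − Φ_j‖₁ − θ_{ij}/π| < ε`. -/
theorem stmt8 {d k N : ℕ} (hkd : k < d) (hkN : k < N) (u : Fin N → Fin d → ℝ)
    (hu : ∀ i, u i ≠ 0) (ε : ℝ) (hε : 0 < ε)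
    (hk : (k : ℝ) = 144 * Real.log N ^ 2 / ε ^ 2) :
    3 / 4 ≤ (((gaussPi d).prod (radPi d))
      {ω : (Fin d → ℝ) × (Fin d → ℝ) | ∀ i j : Fin N,
        max (linf (u i) / l2norm (u i)) (linf (u j) / l2norm (u j))
            < (angle' (u i) (u j)) ^ 2 / (16 * k * Real.log (2 * k * N ^ 2)) →
          |(1 / (2 * (k : ℝ))) *
              l1norm (cbe hkd.le ω.1 ω.2 (u i) - cbe hkd.le ω.1 ω.2 (u j))
            - angle' (u i) (u j) / π| < ε}).toReal := by
  set S := {ω : (Fin d → ℝ) × (Fin d → ℝ) | ∀ i j : Fin N,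
        max (linf (u i) / l2norm (u i)) (linf (u j) / l2norm (u j))
            < (angle' (u i) (u j)) ^ 2 / (16 * k * Real.log (2 * k * N ^ 2)) →
          |(1 / (2 * (k : ℝ))) *
              l1norm (cbe hkd.le ω.1 ω.2 (u i) - cbe hkd.le ω.1 ω.2 (u j))
            - angle' (u i) (u j) / π| < ε} with hS
  set μ := (gaussPi d).prod (radPi d) with hμ
  have hN : (0 : ℝ) < N := by exact_mod_cast (by omega : 0 < N)
  let B : Fin N × Fin N → Set ((Fin d → ℝ) × (Fin d → ℝ)) := fun p =>
    {ω | max (linf (u p.1) / l2norm (u p.1)) (linf (u p.2) / l2norm (u p.2))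
            < (angle' (u p.1) (u p.2)) ^ 2 / (16 * k * Real.log (2 * k * N ^ 2)) ∧
          ε ≤ |(1 / (2 * (k : ℝ))) *
              l1norm (cbe hkd.le ω.1 ω.2 (u p.1) - cbe hkd.le ω.1 ω.2 (u p.2))
            - angle' (u p.1) (u p.2) / π|}
  have hB : ∀ p, μ (B p) ≤ ENNReal.ofReal (1 / (4 * N ^ 2)) := by
    intro p
    by_cases hp : max (linf (u p.1) / l2norm (u p.1)) (linf (u p.2) / l2norm (u p.2))
            < (angle' (u p.1) (u p.2)) ^ 2 / (16 * k * Real.log (2 * k * N ^ 2))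
    · have hk0 : k ≠ 0 := by
        rintro rfl
        have := (div_nonneg (linf_nonneg (u p.1)) (l2norm_pos (hu p.1)).le).trans
          (le_max_left _ (linf (u p.2) / l2norm (u p.2)))
        simp only [Nat.cast_zero, mul_zero, zero_mul, div_zero] at hp
        linarith
      exact (measure_mono fun ω hω => hω.2).trans
        (prod_cbe_failure_le hk0 hkd hkN (hu p.1) (hu p.2) hε hk hp)
    · have : B p = ∅ := Set.eq_empty_of_forall_notMem fun ω hω => hp hω.1
      rw [this, measure_empty]
      exact zero_le
  have hcompl : μ Sᶜ ≤ ENNReal.ofReal (1 / 4) := by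
    have hsub : Sᶜ ⊆ ⋃ p, B p := by
      intro ω hω
      rw [hS, Set.mem_compl_iff, Set.mem_ofPred_eq] at hω
      push Not at hω
      obtain ⟨i, j, h1, h2⟩ := hω
      exact Set.mem_iUnion.2 ⟨(i, j), h1, h2⟩
    calc μ Sᶜ ≤ ∑ p, μ (B p) := (measure_mono hsub).trans (measure_iUnion_fintype_le _ _)
      _ ≤ ∑ _p : Fin N × Fin N, ENNReal.ofReal (1 / (4 * N ^ 2)) :=
          Finset.sum_le_sum fun p _ => hB p
      _ = ENNReal.ofReal (1 / 4) := by
          rw [← ENNReal.ofReal_sum_of_nonneg fun _ _ => by positivity, Finset.sum_const,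
            Finset.card_univ, Fintype.card_prod, Fintype.card_fin, nsmul_eq_mul]
          congr 1
          push_cast
          field_simp
  have h1 : 1 ≤ μ S + μ Sᶜ := by
    rw [← measure_univ (μ := μ), ← Set.union_compl_self S]
    exact measure_union_le _ _
  have h2 : (μ Sᶜ).toReal ≤ 1 / 4 := ENNReal.toReal_le_of_le_ofReal (by norm_num) hcompl
  have h3 : 1 ≤ (μ S).toReal + (μ Sᶜ).toReal := by
    rw [← ENNReal.toReal_add (measure_ne_top _ _) (measure_ne_top _ _), ← ENNReal.toReal_one]
    exact ENNReal.toReal_mono (by finiteness) h1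
  linarith

end
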